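/- arXiv:2010.13256 — 2 statements merged into one kernel-verified Lean document; each statement's English description precedes it below -/
import Mathlib

section
/- Let p_n denote the number of distinct parabolic double cosets in the symmetric group S_n. Then p_n · (log 2)^{2n} / n! converges, as n → ∞, to e^{-(log 2)^2/2} / (4·(log 2)^2), where log denotes the natural logarithm. (Equivalently, p_n ~ K·n!/(log 2)^{2n} with K = e^{-(log 2)^2/2}/(4 (log 2)^2).) -/
/-- The set of simple (adjacent) transpositions `s_i = (i, i+1)` in `S_n`. -/
def simples (n : ℕ) : Set (Equiv.Perm (Fin n)) :=
  { σ | ∃ (i : ℕ) (h : i + 1 < n), σ = Equiv.swap ⟨i, Nat.lt_of_succ_lt h⟩ ⟨i + 1, h⟩ }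

/-- The parabolic double coset `W_I w W_J` as a set of permutations. -/
def doubleCoset {n : ℕ} (I : Set (Equiv.Perm (Fin n))) (w : Equiv.Perm (Fin n))
    (J : Set (Equiv.Perm (Fin n))) : Set (Equiv.Perm (Fin n)) :=
  { u | ∃ x ∈ Subgroup.closure I, ∃ y ∈ Subgroup.closure J, u = x * w * y }

/-- `pdcCount n` is the number of distinct parabolic double cosets in `S_n`. -/
noncomputable def pdcCount (n : ℕ) : ℕ :=
  Nat.card {C : Set (Equiv.Perm (Fin n)) //
    ∃ I ⊆ simples n, ∃ J ⊆ simples n, ∃ w : Equiv.Perm (Fin n), C = doubleCoset I w J}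

/-- A total preorder on `α`, i.e. an ordered set partition of `α`. -/
@[ext]
structure TPre (α : Type*) where
  /-- The underlying relation. -/
  le : α → α → Prop
  total : ∀ a b, le a b ∨ le b a
  trans : ∀ a b c, le a b → le b c → le a c

namespace TPre

variable {α β γ : Type*}

theorem refl (f : TPre α) (a : α) : f.le a a := by
  simpa using f.total a a

theorem le_of_not_le (f : TPre α) {a b : α} (h : ¬ f.le a b) : f.le b a :=
  (f.total a b).resolve_left h

/-- Two elements lie in the same block. -/
def Eqv (f : TPre α) (a b : α) : Prop := f.le a b ∧ f.le b a

/-- The block of `b` is the immediate successor of the block of `a`. -/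
def Cov (f : TPre α) (a b : α) : Prop := ¬ f.le b a ∧ ∀ c, f.le c a ∨ f.le b c

/-- The block of `a` is a singleton. -/
def Single (f : TPre α) (a : α) : Prop := ∀ b, f.Eqv a b → b = a

theorem Eqv.refl (f : TPre α) (a : α) : f.Eqv a a := ⟨f.refl a, f.refl a⟩

theorem Eqv.symm {f : TPre α} {a b : α} (h : f.Eqv a b) : f.Eqv b a := ⟨h.2, h.1⟩

theorem Eqv.trans {f : TPre α} {a b c : α} (h : f.Eqv a b) (h' : f.Eqv b c) : f.Eqv a c :=
  ⟨f.trans _ _ _ h.1 h'.1, f.trans _ _ _ h'.2 h.2⟩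

/-- Pullback of a total preorder. -/
def comap (φ : β → α) (f : TPre α) : TPre β where
  le a b := f.le (φ a) (φ b)
  total _ _ := f.total _ _
  trans _ _ _ := f.trans _ _ _

@[simp] theorem comap_le (φ : β → α) (f : TPre α) (a b : β) :
    (f.comap φ).le a b ↔ f.le (φ a) (φ b) := Iff.rfl

@[simp] theorem comap_eqv (φ : β → α) (f : TPre α) (a b : β) :
    (f.comap φ).Eqv a b ↔ f.Eqv (φ a) (φ b) := Iff.rfl

theorem comap_comap (φ : β → α) (ψ : γ → β) (f : TPre α) :
    (f.comap φ).comap ψ = f.comap (φ ∘ ψ) := rfl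

theorem comap_id (f : TPre α) : f.comap id = f := rfl

theorem comap_cov {φ : β → α} (hφ : Function.Surjective φ) (f : TPre α) (a b : β) :
    (f.comap φ).Cov a b ↔ f.Cov (φ a) (φ b) := by
  unfold Cov
  rw [hφ.forall]
  rfl

theorem comap_injective {φ : β → α} (hφ : Function.Surjective φ) :
    Function.Injective (comap φ) := by
  intro f g h
  ext a b
  obtain ⟨a, rfl⟩ := hφ a
  obtain ⟨b, rfl⟩ := hφ b
  exact iff_of_eq (congrFun (congrFun (congrArg TPre.le h) a) b)

instance [Finite α] : Finite (TPre α) :=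
  Finite.of_injective (fun f : TPre α => f.le) fun _ _ h => TPre.ext h

/-- Transport of total preorders along an equivalence. -/
def congr (e : α ≃ β) : TPre α ≃ TPre β where
  toFun := comap e.symm
  invFun := comap e
  left_inv f := by simp [comap_comap, comap_id]
  right_inv f := by simp [comap_comap, comap_id]

/-- The number of total preorders on an `n`-element set. -/
noncomputable def fub (n : ℕ) : ℕ := Nat.card (TPre (Fin n))

theorem card_eq_fub [Finite α] : Nat.card (TPre α) = fub (Nat.card α) :=
  Nat.card_congr (congr (Finite.equivFin α))

/-- Put the elements outside `S` above those of `S`, forming one top block. -/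
noncomputable def topExtend (S : Set α) (g : TPre S) : TPre α where
  le a b := ∀ hb : b ∈ S, ∃ ha : a ∈ S, g.le ⟨a, ha⟩ ⟨b, hb⟩
  total a b := by
    by_cases ha : a ∈ S <;> by_cases hb : b ∈ S <;> simp [ha, hb]
    exact g.total _ _
  trans a b c h h' hc := by
    obtain ⟨hb, h1⟩ := h' hc
    obtain ⟨ha, h2⟩ := h hb
    exact ⟨ha, g.trans _ _ _ h2 h1⟩

/-- The elements that are not in the top block. -/
def lower (f : TPre α) : Set α := {a | ∃ b, ¬ f.le b a}

theorem lower_ne_univ [Finite α] [Nonempty α] (f : TPre α) : f.lower ≠ Set.univ := by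
  intro h
  have h' : ∀ a : α, ∃ b, ¬ f.le b a := fun a => by
    have : a ∈ f.lower := h ▸ Set.mem_univ a
    exact this
  let r : α → α → Prop := fun a b => ¬ f.le a b
  have : IsTrans α r := ⟨fun a b c h1 h2 h3 => h1 (f.trans _ _ _ h3 (f.le_of_not_le h2))⟩
  have : Std.Irrefl r := ⟨fun a h => h (f.refl a)⟩
  have wf : WellFounded r := Finite.wellFounded_of_trans_of_irrefl r
  obtain ⟨m, -, hm⟩ := wf.has_min Set.univ Set.univ_nonempty
  obtain ⟨b, hb⟩ := h' m
  exact hm b trivial hb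

/-- Removing the top block. -/
noncomputable def topEquiv [Finite α] [Nonempty α] :
    TPre α ≃ Σ S : {S : Set α // S ≠ Set.univ}, TPre S.1 where
  toFun f := ⟨⟨f.lower, f.lower_ne_univ⟩, f.comap Subtype.val⟩
  invFun x := topExtend x.1.1 x.2
  left_inv f := by
    ext a b
    simp only [topExtend, comap_le, exists_prop]
    constructor
    · intro h
      by_cases hb : b ∈ f.lower
      · exact (h hb).2
      · by_contra hc
        exact hb ⟨a, hc⟩
    · rintro h ⟨c, hc⟩
      exact ⟨⟨c, fun h' => hc (f.trans _ _ _ h' h)⟩, h⟩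
  right_inv := by
    rintro ⟨⟨S, hS⟩, g⟩
    have h1 : (topExtend S g).lower = S := by
      ext a
      simp only [lower, topExtend, Set.mem_ofPred_eq]
      constructor
      · rintro ⟨b, hb⟩
        by_contra ha
        exact hb fun h => absurd h ha
      · intro ha
        obtain ⟨b, hb⟩ := (Set.ne_univ_iff_exists_notMem S).1 hS
        exact ⟨b, fun h => hb (h ha).1⟩
    have key : ∀ (T : Set α) (hT : T ≠ Set.univ), T = S →
        (⟨⟨T, hT⟩, (topExtend S g).comap Subtype.val⟩ :
          Σ S : {S : Set α // S ≠ Set.univ}, TPre S.1) = ⟨⟨S, hS⟩, g⟩ := by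
      rintro T hT rfl
      congr 1
      ext a b
      simp [topExtend]
    exact key _ _ h1

theorem fub_zero : fub 0 = 1 := by
  have : Unique (TPre (Fin 0)) :=
    { default := ⟨fun _ _ => True, fun _ _ => Or.inl trivial, fun _ _ _ _ _ => trivial⟩
      uniq := fun f => by ext a; exact a.elim0 }
  exact Nat.card_unique

theorem fub_succ (n : ℕ) :
    fub (n + 1) = ∑ k ∈ Finset.range (n + 1), (n + 1).choose k * fub k := by
  classical
  have h1 : fub (n + 1) = ∑ S : {S : Finset (Fin (n + 1)) // S ≠ Finset.univ}, fub S.1.card := by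
    rw [fub, Nat.card_congr topEquiv, Nat.card_sigma]
    refine Fintype.sum_equiv
      (Equiv.ofBijective (fun S : {S : Set (Fin (n + 1)) // S ≠ Set.univ} =>
        (⟨S.1.toFinset, by simpa using S.2⟩ :
          {S : Finset (Fin (n + 1)) // S ≠ Finset.univ})) ⟨?_, ?_⟩) _ _ ?_
    · rintro ⟨S, hS⟩ ⟨T, hT⟩ h
      simpa using h
    · rintro ⟨S, hS⟩
      exact ⟨⟨S, by simpa using hS⟩, by simp⟩
    · rintro ⟨S, hS⟩
      rw [card_eq_fub]
      congr 1
      rw [Nat.card_eq_fintype_card]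
      exact (Set.toFinset_card S).symm
  have h2 := Finset.sum_powerset_apply_card fub (x := (Finset.univ : Finset (Fin (n + 1))))
  rw [Finset.powerset_univ, Finset.card_univ, Fintype.card_fin, Finset.sum_range_succ,
    ← Finset.sum_filter_add_sum_filter_not _ (fun S : Finset (Fin (n + 1)) => S ≠ Finset.univ)] at h2
  simp only [ne_eq, not_not, Finset.filter_eq', Finset.mem_univ, if_true, Finset.sum_singleton,
    Finset.card_univ, Fintype.card_fin, Nat.choose_self, one_mul, smul_eq_mul] at h2
  have h3 := Nat.add_right_cancel h2
  rw [h1, ← h3]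
  exact (Finset.sum_subtype (p := fun S => S ≠ Finset.univ) _
    (fun S => (Finset.mem_filter_univ S)) (fun S => fub S.card)).symm
end TPre

section

open Finset Filter Topology

namespace TPre

/-- The tail `∑_{k > j} (log 2)^k / k!` of the exponential series at `log 2`. -/
noncomputable def expTail (j : ℕ) : ℝ :=
  2 - ∑ k ∈ range (j + 1), Real.log 2 ^ k / k.factorial

theorem log_two_pos : 0 < Real.log 2 := Real.log_pos (by norm_num)

theorem log_two_lt_one : Real.log 2 < 1 := by
  have := Real.log_two_lt_d9
  linarith

theorem expTail_zero : expTail 0 = 1 := by norm_num [expTail]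

theorem expTail_succ (j : ℕ) :
    expTail (j + 1) = expTail j - Real.log 2 ^ (j + 1) / (j + 1).factorial := by
  rw [expTail, sum_range_succ, expTail]
  ring

theorem expTail_nonneg (j : ℕ) : 0 ≤ expTail j := by
  have h := Real.sum_le_exp_of_nonneg log_two_pos.le (j + 1)
  rw [Real.exp_log (by norm_num)] at h
  rw [expTail]
  linarith

theorem expTail_le (j : ℕ) : expTail j ≤ 2 / (j + 1).factorial := by
  have h := Real.exp_bound' log_two_pos.le log_two_lt_one.le (n := j + 1) (Nat.succ_pos j)
  rw [Real.exp_log (by norm_num)] at h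
  have h1 : Real.log 2 ^ (j + 1) ≤ 1 := pow_le_one₀ log_two_pos.le log_two_lt_one.le
  have h2 : Real.log 2 ^ (j + 1) * ((j + 1 : ℕ) + 1) / ((j + 1).factorial * (j + 1 : ℕ)) ≤
      2 / (j + 1).factorial := by
    rw [div_le_div_iff₀ (by positivity) (by positivity)]
    have h3 : Real.log 2 ^ (j + 1) * ((j + 1 : ℕ) + 1) ≤ 2 * (j + 1 : ℕ) := by
      have : (1 : ℝ) ≤ (j + 1 : ℕ) := by exact_mod_cast Nat.succ_pos j
      nlinarith [pow_nonneg log_two_pos.le (j + 1)]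
    have h4 : (0 : ℝ) < (j + 1).factorial := by positivity
    nlinarith
  rw [expTail]
  linarith

theorem sum_expTail (N : ℕ) : ∑ j ∈ range N, expTail j =
    N * expTail N + Real.log 2 * ∑ j ∈ range N, Real.log 2 ^ j / j.factorial := by
  induction N with
  | zero => simp
  | succ N ih =>
    rw [sum_range_succ, ih, expTail_succ, sum_range_succ _ N, Nat.factorial_succ]
    have h : ((N.factorial : ℕ) : ℝ) ≠ 0 := by positivity
    have h' : ((N : ℝ) + 1) ≠ 0 := by positivity
    push_cast
    field_simp
    ring

theorem tendsto_sum_expTail :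
    Tendsto (fun N => ∑ j ∈ range N, expTail j) atTop (𝓝 (2 * Real.log 2)) := by
  have h1 : Tendsto (fun N : ℕ => (N : ℝ) * expTail N) atTop (𝓝 0) := by
    refine squeeze_zero (fun N => mul_nonneg (Nat.cast_nonneg _) (expTail_nonneg N))
      (g := fun N : ℕ => 2 * (1 / (N.factorial : ℝ))) (fun N => ?_) ?_
    · refine (mul_le_mul_of_nonneg_left (expTail_le N) (Nat.cast_nonneg _)).trans ?_
      rw [Nat.factorial_succ, mul_one_div, ← mul_div_assoc,
        div_le_div_iff₀ (by positivity) (by positivity)]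
      push_cast
      have : (0 : ℝ) < N.factorial := by positivity
      nlinarith
    · have := (FloorSemiring.tendsto_pow_div_factorial_atTop (1 : ℝ)).const_mul 2
      simpa using this
  have h2 : Tendsto (fun N => ∑ j ∈ range N, Real.log 2 ^ j / (j.factorial : ℝ)) atTop (𝓝 2) := by
    have := (NormedSpace.expSeries_div_hasSum_exp (Real.log 2)).tendsto_sum_nat
    rwa [← Real.exp_eq_exp_ℝ, Real.exp_log (by norm_num)] at this
  have h3 := h1.add (h2.const_mul (Real.log 2))
  simp only [← sum_expTail] at h3
  convert h3 using 2
  ring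

theorem hasSum_expTail : HasSum expTail (2 * Real.log 2) :=
  (hasSum_iff_tendsto_nat_of_nonneg expTail_nonneg _).2 tendsto_sum_expTail

/-- The normalized Fubini numbers. -/
noncomputable def nfub (n : ℕ) : ℝ := fub n * Real.log 2 ^ n / n.factorial

theorem nfub_zero : nfub 0 = 1 := by simp [nfub, fub_zero]

theorem nfub_succ (n : ℕ) : nfub (n + 1) =
    ∑ k ∈ range (n + 1), Real.log 2 ^ (n + 1 - k) / (n + 1 - k).factorial * nfub k := by
  rw [nfub, fub_succ]
  push_cast
  rw [sum_mul, sum_div]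
  refine sum_congr rfl fun k hk => ?_
  have hk' : k ≤ n + 1 := by
    have := mem_range.1 hk
    omega
  rw [nfub, Nat.cast_choose ℝ hk']
  have h : Real.log 2 ^ (n + 1) = Real.log 2 ^ (n + 1 - k) * Real.log 2 ^ k := by
    rw [← pow_add]
    congr 1
    omega
  rw [h]
  field_simp

theorem sum_expTail_mul_nfub (n : ℕ) : ∑ k ∈ range (n + 1), expTail (n - k) * nfub k = 1 := by
  induction n with
  | zero => simp [expTail_zero, nfub_zero]
  | succ n ih =>
    rw [sum_range_succ, Nat.sub_self, expTail_zero, one_mul, nfub_succ, ← sum_add_distrib, ← ih]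
    refine sum_congr rfl fun k hk => ?_
    have hk' : n + 1 - k = n - k + 1 := by
      have := mem_range.1 hk
      omega
    rw [hk', expTail_succ]
    ring

/-- The increments of the normalized Fubini numbers. -/
noncomputable def dfub : ℕ → ℝ
  | 0 => 1
  | n + 1 => nfub (n + 1) - nfub n

theorem sum_dfub (n : ℕ) : ∑ k ∈ range (n + 1), dfub k = nfub n := by
  induction n with
  | zero => simp [dfub, nfub_zero]
  | succ n ih => rw [sum_range_succ, ih, dfub]; ring

theorem sum_expTail_mul_dfub (n : ℕ) :
    ∑ k ∈ range (n + 2), expTail (n + 1 - k) * dfub k = 0 := by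
  rw [sum_range_succ']
  simp only [dfub, Nat.add_sub_add_right, mul_sub, sum_sub_distrib, sum_expTail_mul_nfub]
  have h := sum_expTail_mul_nfub (n + 1)
  rw [sum_range_succ'] at h
  simp only [Nat.add_sub_add_right, nfub_zero] at h
  linarith

theorem sum_abs_dfub_succ (N : ℕ) : ∑ n ∈ range N, |dfub (n + 1)| ≤
    (2 * Real.log 2 - 1) * ∑ n ∈ range N, |dfub n| := by
  have h1 : ∀ n, |dfub (n + 1)| ≤ ∑ k ∈ range (n + 1), expTail (n - k + 1) * |dfub k| := by
    intro n
    have h := sum_expTail_mul_dfub n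
    rw [sum_range_succ, Nat.sub_self, expTail_zero, one_mul] at h
    rw [eq_neg_of_add_eq_zero_right h, abs_neg]
    refine (abs_sum_le_sum_abs _ _).trans (le_of_eq (sum_congr rfl fun k hk => ?_))
    have hk' : n + 1 - k = n - k + 1 := by
      have := mem_range.1 hk
      omega
    rw [hk', abs_mul, abs_of_nonneg (expTail_nonneg _)]
  refine (sum_le_sum fun n _ => h1 n).trans ?_
  rw [sum_comm' (t' := range N) (s' := fun k => Ico k N)
    (by intro n k; simp only [mem_range, mem_Ico]; omega), mul_sum]
  refine sum_le_sum fun k _ => ?_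
  rw [← sum_mul]
  refine mul_le_mul_of_nonneg_right ?_ (abs_nonneg _)
  rw [sum_Ico_eq_sum_range]
  have h2 := sum_le_hasSum (range (N - k + 1)) (fun j _ => expTail_nonneg j) hasSum_expTail
  rw [sum_range_succ', expTail_zero] at h2
  simp only [Nat.add_sub_cancel_left]
  linarith

theorem summable_abs_dfub : Summable fun n => |dfub n| := by
  refine summable_of_sum_range_le (c := 1 / (2 - 2 * Real.log 2)) (fun n => abs_nonneg _) fun N => ?_
  have h0 : 0 < 2 - 2 * Real.log 2 := by linarith [log_two_lt_one]
  have h1 := sum_abs_dfub_succ N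
  have h2 : ∑ n ∈ range N, |dfub n| ≤ ∑ n ∈ range (N + 1), |dfub n| :=
    sum_le_sum_of_subset_of_nonneg (range_mono (Nat.le_succ N)) fun _ _ _ => abs_nonneg _
  rw [sum_range_succ'] at h2
  have h3 : |dfub 0| = 1 := by simp [dfub]
  rw [h3] at h2
  rw [le_div_iff₀ h0]
  linarith

theorem tendsto_nfub : Tendsto nfub atTop (𝓝 (1 / (2 * Real.log 2))) := by
  have hs : Summable dfub := summable_abs_dfub.of_abs
  have h1 : Tendsto nfub atTop (𝓝 (∑' n, dfub n)) := by
    have := (tendsto_add_atTop_iff_nat 1).2 hs.hasSum.tendsto_sum_nat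
    simpa only [sum_dfub] using this
  have h2 := tsum_mul_tsum_eq_tsum_sum_range_of_summable_norm
    (f := dfub) (g := expTail) summable_abs_dfub hasSum_expTail.summable.norm
  have h4 : ∑' n, ∑ k ∈ range (n + 1), dfub k * expTail (n - k) = 1 := by
    rw [tsum_eq_single 0]
    · simp [dfub, expTail_zero]
    · intro n hn
      obtain ⟨n, rfl⟩ := Nat.exists_eq_succ_of_ne_zero hn
      rw [← sum_expTail_mul_dfub n]
      exact sum_congr rfl fun k _ => mul_comm _ _
  rw [hasSum_expTail.tsum_eq, h4] at h2
  rwa [one_div, ← eq_inv_of_mul_eq_one_left h2]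

end TPre

end

section

open Finset Filter Topology

namespace TPre

/-- The number of cycles (fixed points included) of a permutation. -/
noncomputable def cyc {α : Type*} (π : Equiv.Perm α) : ℕ :=
  Nat.card (Quotient (Equiv.Perm.SameCycle.setoid π))

theorem apply_eq_of_sameCycle {α β : Type*} [Finite α] {π : Equiv.Perm α} {ψ : α → β}
    (h : ∀ a, ψ (π a) = ψ a) {a b : α} (hab : π.SameCycle a b) : ψ a = ψ b := by
  obtain ⟨k, -, rfl⟩ := hab.exists_pow_eq'
  induction k with
  | zero => rfl
  | succ k ih =>
    rw [pow_succ', Equiv.Perm.mul_apply, h]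
    exact ih ⟨k, rfl⟩

theorem cyc_decomposeFin_zero {n : ℕ} (e : Equiv.Perm (Fin n)) :
    cyc (Equiv.Perm.decomposeFin.symm (0, e)) = cyc e + 1 := by
  set π := Equiv.Perm.decomposeFin.symm (0, e) with hπ
  have hz : π 0 = 0 := by simp [hπ]
  have hs : ∀ a, π (Fin.succ a) = Fin.succ (e a) := fun a => by simp [hπ]
  let ψ : Fin (n + 1) → Option (Quotient (Equiv.Perm.SameCycle.setoid e)) :=
    Fin.cases none fun a => some (Quotient.mk _ a)
  have hψ : ∀ a, ψ (π a) = ψ a := by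
    intro a
    refine Fin.cases ?_ (fun a => ?_) a
    · rw [hz]
    · rw [hs]
      exact congrArg some (Quotient.sound (Equiv.Perm.sameCycle_apply_left.2
        (Equiv.Perm.SameCycle.refl _ _)))
  have hq : ∀ a, Quotient.mk (Equiv.Perm.SameCycle.setoid π) (Fin.succ (e a)) =
      Quotient.mk (Equiv.Perm.SameCycle.setoid π) (Fin.succ a) := fun a => by
    rw [← hs]
    exact Quotient.sound (Equiv.Perm.sameCycle_apply_left.2 (Equiv.Perm.SameCycle.refl _ _))
  have : Quotient (Equiv.Perm.SameCycle.setoid π) ≃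
      Option (Quotient (Equiv.Perm.SameCycle.setoid e)) :=
    { toFun := Quotient.lift ψ fun a b h => apply_eq_of_sameCycle hψ h
      invFun := fun o => o.elim (Quotient.mk _ 0)
        (Quotient.lift (fun a => Quotient.mk _ (Fin.succ a))
          fun a b h => apply_eq_of_sameCycle
            (ψ := fun a => Quotient.mk (Equiv.Perm.SameCycle.setoid π) (Fin.succ a)) hq h)
      left_inv := by
        rintro ⟨a⟩
        refine Fin.cases rfl (fun a => rfl) a
      right_inv := by
        rintro (_ | ⟨⟨a⟩⟩) <;> rfl }
  rw [cyc, Nat.card_congr this, Finite.card_option]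
  rfl

theorem cyc_decomposeFin_succ {n : ℕ} (q : Fin n) (e : Equiv.Perm (Fin n)) :
    cyc (Equiv.Perm.decomposeFin.symm (q.succ, e)) = cyc e := by
  set π := Equiv.Perm.decomposeFin.symm (q.succ, e) with hπ
  have hz : π 0 = q.succ := by simp [hπ]
  have hs : ∀ a, π (Fin.succ a) = Equiv.swap 0 q.succ (Fin.succ (e a)) := fun a => by simp [hπ]
  let ψ : Fin (n + 1) → Quotient (Equiv.Perm.SameCycle.setoid e) :=
    Fin.cases (Quotient.mk _ q) fun a => Quotient.mk _ a
  have hstep : ∀ a, Quotient.mk (Equiv.Perm.SameCycle.setoid e) (e a) = Quotient.mk _ a :=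
    fun a => Quotient.sound (Equiv.Perm.sameCycle_apply_left.2 (Equiv.Perm.SameCycle.refl _ _))
  have hstep' : ∀ a, Quotient.mk (Equiv.Perm.SameCycle.setoid π) (π a) = Quotient.mk _ a :=
    fun a => Quotient.sound (Equiv.Perm.sameCycle_apply_left.2 (Equiv.Perm.SameCycle.refl _ _))
  have hψ : ∀ a, ψ (π a) = ψ a := by
    intro a
    refine Fin.cases ?_ (fun a => ?_) a
    · rw [hz]
      rfl
    · rw [hs]
      by_cases h : e a = q
      · rw [h, Equiv.swap_apply_right]
        exact (congrArg (Quotient.mk _) h.symm).trans (hstep a)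
      · rw [Equiv.swap_apply_of_ne_of_ne (Fin.succ_ne_zero _) (by simpa using h)]
        exact hstep a
  have hq : ∀ a, Quotient.mk (Equiv.Perm.SameCycle.setoid π) (Fin.succ (e a)) =
      Quotient.mk (Equiv.Perm.SameCycle.setoid π) (Fin.succ a) := fun a => by
    rw [← hstep' (Fin.succ a), hs]
    by_cases h : e a = q
    · rw [h, Equiv.swap_apply_right, ← hstep' 0, hz]
    · rw [Equiv.swap_apply_of_ne_of_ne (Fin.succ_ne_zero _) (by simpa using h)]
  refine Nat.card_congr
    { toFun := Quotient.lift ψ fun a b h => apply_eq_of_sameCycle hψ h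
      invFun := Quotient.lift (fun a => Quotient.mk _ (Fin.succ a))
          fun a b h => apply_eq_of_sameCycle
            (ψ := fun a => Quotient.mk (Equiv.Perm.SameCycle.setoid π) (Fin.succ a)) hq h
      left_inv := ?_
      right_inv := ?_ }
  · rintro ⟨a⟩
    refine Fin.cases ?_ (fun a => rfl) a
    change Quotient.mk _ q.succ = Quotient.mk _ 0
    rw [← hz, hstep']
  · rintro ⟨a⟩
    rfl

/-- The number of permutations of `n` points with `n - j` cycles. -/
def cycNum : ℕ → ℕ → ℕ
  | _, 0 => 1
  | 0, _ + 1 => 0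
  | n + 1, j + 1 => cycNum n (j + 1) + n * cycNum n j

theorem cycNum_eq_zero {n j : ℕ} (h : n < j) : cycNum n j = 0 := by
  induction n generalizing j with
  | zero => cases j <;> simp_all [cycNum]
  | succ n ih =>
    cases j with
    | zero => simp at h
    | succ j => simp [cycNum, ih (show n < j by omega), ih (show n < j + 1 by omega)]

theorem sum_cyc (n : ℕ) (h : ℕ → ℝ) :
    ∑ π : Equiv.Perm (Fin n), h (cyc π) = ∑ j ∈ range (n + 1), (cycNum n j : ℝ) * h (n - j) := by
  induction n generalizing h with
  | zero =>
    simp [cycNum, cyc]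
  | succ n ih =>
    rw [← Equiv.Perm.decomposeFin.symm.sum_comp, Fintype.sum_prod_type, Fin.sum_univ_succ]
    simp only [cyc_decomposeFin_zero, cyc_decomposeFin_succ]
    rw [ih (fun k => h (k + 1)), ih h, Finset.sum_range_succ' _ (n + 1)]
    simp only [cycNum, sum_const, card_univ, Fintype.card_fin, nsmul_eq_mul, Nat.cast_add,
      Nat.cast_mul, add_mul, sum_add_distrib, Nat.add_sub_add_right, Nat.cast_one, one_mul,
      Nat.sub_zero, mul_sum, mul_assoc]
    have e1 : ∑ j ∈ range (n + 1), (cycNum n j : ℝ) * h (n - j + 1) =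
        ∑ j ∈ range (n + 1), (cycNum n (j + 1) : ℝ) * h (n - j) + h (n + 1) := by
      rw [sum_range_succ', sum_range_succ (fun j => (cycNum n (j + 1) : ℝ) * h (n - j)),
        cycNum_eq_zero (Nat.lt_succ_self n)]
      simp only [cycNum, Nat.cast_one, one_mul, Nat.sub_zero, Nat.cast_zero, zero_mul, add_zero]
      congr 1
      refine sum_congr rfl fun j hj => ?_
      rw [mem_range] at hj
      rw [show n - (j + 1) + 1 = n - j by omega]
    rw [e1]
    ring

theorem cycNum_le (n j : ℕ) : (cycNum n j : ℝ) ≤ ((n : ℝ) ^ 2 / 2) ^ j / j.factorial := by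
  induction n generalizing j with
  | zero =>
    cases j <;> simp [cycNum]
  | succ n ih =>
    cases j with
    | zero => simp [cycNum]
    | succ j =>
      have h1 := ih (j + 1)
      have h2 := ih j
      have h3 : (0 : ℝ) ≤ (n : ℝ) := n.cast_nonneg
      simp only [cycNum, Nat.cast_add, Nat.cast_mul, Nat.cast_one]
      have h4 : ((n : ℝ) ^ 2 / 2) ^ (j + 1) / (j + 1).factorial +
          n * (((n : ℝ) ^ 2 / 2) ^ j / j.factorial) ≤
          (((n : ℝ) + 1) ^ 2 / 2) ^ (j + 1) / (j + 1).factorial := by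
        have h5 : ((n : ℝ) ^ 2 / 2) ^ (j + 1) + (j + 1) * (n * ((n : ℝ) ^ 2 / 2) ^ j) ≤
            (((n : ℝ) + 1) ^ 2 / 2) ^ (j + 1) := by
          have h6 : ((n : ℝ) ^ 2 / 2) ^ (j + 1) + (j + 1 : ℕ) * ((n : ℝ) ^ 2 / 2) ^ j * (n + 1 / 2)
              ≤ ((n : ℝ) ^ 2 / 2 + (n + 1 / 2)) ^ (j + 1) := by
            exact pow_add_mul_le_add_pow (by positivity) (by positivity) (j + 1)
          have h7 : ((n : ℝ) ^ 2 / 2 + (n + 1 / 2)) = ((n : ℝ) + 1) ^ 2 / 2 := by ring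
          rw [h7] at h6
          refine le_trans ?_ h6
          push_cast
          have : 0 ≤ ((j : ℝ) + 1) * ((n : ℝ) ^ 2 / 2) ^ j := by positivity
          nlinarith
        rw [Nat.factorial_succ, Nat.cast_mul]
        have hj : (0 : ℝ) < j.factorial := by positivity
        have hj1 : (0 : ℝ) < (j + 1 : ℕ) := by positivity
        calc _ = (((n : ℝ) ^ 2 / 2) ^ (j + 1) + (j + 1) * (n * ((n : ℝ) ^ 2 / 2) ^ j)) /
            ((j + 1 : ℕ) * j.factorial) := by
              field_simp
              push_cast
              ring
          _ ≤ _ := by gcongr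
      have h6 := mul_le_mul_of_nonneg_left h2 h3
      linarith

theorem descFactorial_le_cycNum (n j : ℕ) :
    n.descFactorial (2 * j) ≤ 2 ^ j * j.factorial * cycNum n j := by
  induction n generalizing j with
  | zero =>
    cases j with
    | zero => simp [cycNum]
    | succ j => simp [Nat.mul_succ]
  | succ n ih =>
    cases j with
    | zero => simp [cycNum]
    | succ j =>
      have h1 := ih (j + 1)
      have h2 := ih j
      have h3 : (n + 1).descFactorial (2 * (j + 1)) =
          n.descFactorial (2 * (j + 1)) + 2 * (j + 1) * n.descFactorial (2 * j + 1) := by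
        rw [show 2 * (j + 1) = 2 * j + 1 + 1 by ring, Nat.succ_descFactorial_succ,
          Nat.descFactorial_succ n (2 * j + 1)]
        rcases le_or_gt (2 * j + 1) n with h | h
        · obtain ⟨m, rfl⟩ := Nat.exists_eq_add_of_le h
          rw [Nat.add_sub_cancel_left]
          ring
        · rw [Nat.descFactorial_of_lt h]
          simp
      have h4 : n.descFactorial (2 * j + 1) ≤ n * n.descFactorial (2 * j) := by
        rw [Nat.descFactorial_succ]
        exact Nat.mul_le_mul_right _ (Nat.sub_le _ _)
      calc (n + 1).descFactorial (2 * (j + 1))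
          ≤ 2 ^ (j + 1) * (j + 1).factorial * cycNum n (j + 1) +
            2 * (j + 1) * (n * (2 ^ j * j.factorial * cycNum n j)) := by
            rw [h3]
            exact Nat.add_le_add h1 (Nat.mul_le_mul_left _ (h4.trans (Nat.mul_le_mul_left _ h2)))
        _ = _ := by
            rw [cycNum, Nat.factorial_succ]
            ring

theorem tendsto_descFactorial_div (k : ℕ) :
    Tendsto (fun n : ℕ => (n.descFactorial k : ℝ) / (n : ℝ) ^ k) atTop (𝓝 1) := by
  induction k with
  | zero => simp
  | succ k ih =>
    have h1 : Tendsto (fun n : ℕ => 1 - (k : ℝ) / (n : ℝ)) atTop (𝓝 (1 - 0)) :=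
      tendsto_const_nhds.sub (tendsto_const_div_atTop_nhds_zero_nat _)
    have h2 := h1.mul ih
    rw [sub_zero, one_mul] at h2
    refine h2.congr' ?_
    filter_upwards [eventually_gt_atTop k] with n hn
    have hn0 : (n : ℝ) ≠ 0 := by
      have : n ≠ 0 := by omega
      exact_mod_cast this
    rw [Nat.descFactorial_succ, Nat.cast_mul, Nat.cast_sub hn.le]
    field_simp
    ring

theorem tendsto_cycNum_div (j : ℕ) :
    Tendsto (fun n : ℕ => (cycNum n j : ℝ) / (n : ℝ) ^ (2 * j)) atTop
      (𝓝 (1 / (2 ^ j * j.factorial))) := by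
  have h1 := (tendsto_descFactorial_div (2 * j)).mul_const (1 / (2 ^ j * (j.factorial : ℝ)))
  rw [one_mul] at h1
  refine tendsto_of_tendsto_of_tendsto_of_le_of_le' h1 tendsto_const_nhds ?_ ?_
  · filter_upwards [eventually_gt_atTop 0] with n hn
    have h2 : (n.descFactorial (2 * j) : ℝ) ≤ 2 ^ j * j.factorial * cycNum n j := by
      exact_mod_cast descFactorial_le_cycNum n j
    have hn0 : (0 : ℝ) < n := by exact_mod_cast hn
    rw [div_mul_div_comm, mul_one, div_le_div_iff₀ (by positivity) (by positivity)]
    have := mul_le_mul_of_nonneg_right h2 (pow_nonneg hn0.le (2 * j))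
    linarith
  · filter_upwards [eventually_gt_atTop 0] with n hn
    have hn0 : (0 : ℝ) < n := by exact_mod_cast hn
    rw [div_le_iff₀ (by positivity)]
    refine (cycNum_le n j).trans (le_of_eq ?_)
    rw [div_pow, pow_mul]
    field_simp

end TPre

end

namespace TPre

section NoMerge

variable {α β : Type*}

/-- No two consecutive blocks of `f` have their union inside a block of `g`. -/
def NoMerge (f g : TPre α) : Prop :=
  ¬ ∃ p q, f.Cov p q ∧ ∀ z, f.Eqv z p ∨ f.Eqv z q → g.Eqv z p

/-- Neither of the two preorders has consecutive blocks that can be merged. -/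
def Reduced (f g : TPre α) : Prop := NoMerge f g ∧ NoMerge g f

theorem noMerge_comap {φ : β → α} (hφ : Function.Surjective φ) (f g : TPre α) :
    NoMerge (f.comap φ) (g.comap φ) ↔ NoMerge f g := by
  unfold NoMerge
  simp only [comap_cov hφ, comap_eqv]
  refine not_congr ⟨?_, ?_⟩
  · rintro ⟨p, q, h1, h2⟩
    exact ⟨φ p, φ q, h1, hφ.forall.2 h2⟩
  · rintro ⟨p, q, h1, h2⟩
    obtain ⟨p, rfl⟩ := hφ p
    obtain ⟨q, rfl⟩ := hφ q
    exact ⟨p, q, h1, fun z => h2 (φ z)⟩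

theorem reduced_comap {φ : β → α} (hφ : Function.Surjective φ) (f g : TPre α) :
    Reduced (f.comap φ) (g.comap φ) ↔ Reduced f g :=
  and_congr (noMerge_comap hφ f g) (noMerge_comap hφ g f)

theorem Reduced.symm {f g : TPre α} (h : Reduced f g) : Reduced g f := ⟨h.2, h.1⟩

variable (α) in
/-- Reduced pairs of total preorders. -/
abbrev RedPair := {x : TPre α × TPre α // Reduced x.1 x.2}

/-- Transport of reduced pairs along an equivalence. -/
def RedPair.congr (e : α ≃ β) : RedPair α ≃ RedPair β where
  toFun x := ⟨(x.1.1.comap e.symm, x.1.2.comap e.symm),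
    (reduced_comap e.symm.surjective _ _).2 x.2⟩
  invFun x := ⟨(x.1.1.comap e, x.1.2.comap e), (reduced_comap e.surjective _ _).2 x.2⟩
  left_inv x := by simp [comap_comap, comap_id]
  right_inv x := by simp [comap_comap, comap_id]

/-- The number of reduced pairs on an `n`-element set. -/
noncomputable def red (n : ℕ) : ℕ := Nat.card (RedPair (Fin n))

theorem card_redPair [Finite α] : Nat.card (RedPair α) = red (Nat.card α) :=
  Nat.card_congr (RedPair.congr (Finite.equivFin α))

instance : MulAction (Equiv.Perm α) (RedPair α) where
  smul σ x := RedPair.congr σ x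
  one_smul _ := rfl
  mul_smul _ _ _ := rfl

end NoMerge

section Stab

variable {α : Type*}

/-- The permutations preserving every block of `f`. -/
def stab (f : TPre α) : Subgroup (Equiv.Perm α) where
  carrier := {w | ∀ a, f.Eqv a (w a)}
  one_mem' a := Eqv.refl f a
  mul_mem' {v w} hv hw a := (hw a).trans (hv (w a))
  inv_mem' {w} hw a := by simpa using (hw (w⁻¹ a)).symm

theorem mem_stab {f : TPre α} {w : Equiv.Perm α} : w ∈ stab f ↔ ∀ a, f.Eqv a (w a) := Iff.rfl

theorem comap_of_mem_stab {f : TPre α} {w : Equiv.Perm α} (h : w ∈ stab f) : f.comap w = f := by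
  ext a b
  exact ⟨fun h' => f.trans _ _ _ (h a).1 (f.trans _ _ _ h' (h b).2),
    fun h' => f.trans _ _ _ (h a).2 (f.trans _ _ _ h' (h b).1)⟩

theorem mem_stab_of_comap [Finite α] {f : TPre α} {w : Equiv.Perm α} (h : f.comap w = f) :
    w ∈ stab f := by
  have hw : ∀ a b, f.le (w a) (w b) ↔ f.le a b := fun a b => by
    rw [← comap_le, h]
  have key : ∀ v : Equiv.Perm α, (∀ a b, f.le (v a) (v b) ↔ f.le a b) →
      ∀ a, f.le a (v a) → f.le (v a) a := by
    intro v hv a ha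
    have h1 : ∀ k : ℕ, f.le (v a) ((v ^ (k + 1)) a) := by
      intro k
      induction k with
      | zero => exact f.refl _
      | succ k ih =>
        refine f.trans _ _ _ ((hv _ _).2 ha) ?_
        rw [pow_succ']
        exact (hv _ _).2 ih
    have h2 := h1 (orderOf v - 1)
    rwa [Nat.sub_add_cancel (orderOf_pos v), pow_orderOf_eq_one] at h2
  intro a
  rcases f.total a (w a) with h1 | h1
  · exact ⟨h1, key w hw a h1⟩
  · refine ⟨?_, h1⟩
    have := key w⁻¹ (fun a b => by rw [← hw]; simp) (w a) (by simpa using h1)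
    simpa using this

theorem swap_mem_stab [DecidableEq α] {f : TPre α} {a b : α} (h : f.Eqv a b) :
    Equiv.swap a b ∈ stab f := by
  intro c
  rcases eq_or_ne c a with rfl | h1
  · simpa using h
  rcases eq_or_ne c b with rfl | h2
  · simpa using h.symm
  rw [Equiv.swap_apply_of_ne_of_ne h1 h2]
  exact Eqv.refl f c

/-- Fixed points of a permutation correspond to reduced pairs on its set of cycles. -/
theorem card_fixedBy [Finite α] (π : Equiv.Perm α) :
    Nat.card (MulAction.fixedBy (RedPair α) π) = red (cyc π) := by
  rw [cyc, ← card_redPair]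
  symm
  let s := Equiv.Perm.SameCycle.setoid π
  have hmk : Function.Surjective (Quotient.mk s) := Quotient.mk_surjective
  have hfix : ∀ f : TPre (Quotient s), (f.comap (Quotient.mk s)).comap π.symm =
      f.comap (Quotient.mk s) := by
    intro f
    rw [comap_comap]
    congr 1
    funext a
    exact Quotient.sound (Equiv.Perm.sameCycle_symm_apply_left.2 (Equiv.Perm.SameCycle.refl _ _))
  have hlift : ∀ f : TPre α, f.comap π.symm = f →
      (f.comap (Quotient.out (s := s))).comap (Quotient.mk s) = f := by
    intro f hf
    have h1 : π ∈ stab f := by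
      have := (stab f).inv_mem (mem_stab_of_comap (w := π⁻¹) hf)
      rwa [inv_inv] at this
    have h2 : ∀ a, f.Eqv a (Quotient.mk s a).out := by
      intro a
      have h3 : π.SameCycle a (Quotient.mk s a).out :=
        (Quotient.exact (Quotient.out_eq (Quotient.mk s a))).symm
      obtain ⟨k, hk⟩ := h3
      rw [← hk]
      exact (stab f).zpow_mem h1 k a
    ext a b
    rw [comap_comap, comap_le]
    exact ⟨fun h => f.trans _ _ _ (h2 a).1 (f.trans _ _ _ h (h2 b).2),
      fun h => f.trans _ _ _ (h2 a).2 (f.trans _ _ _ h (h2 b).1)⟩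
  refine Nat.card_congr (Equiv.ofBijective (fun x : RedPair (Quotient s) =>
    (⟨⟨(x.1.1.comap (Quotient.mk s), x.1.2.comap (Quotient.mk s)),
      (reduced_comap hmk _ _).2 x.2⟩, ?_⟩ : MulAction.fixedBy (RedPair α) π)) ⟨?_, ?_⟩)
  · exact Subtype.ext (Prod.ext (hfix _) (hfix _))
  · intro x y h
    have h1 := congrArg (fun z => z.1.1) h
    exact Subtype.ext (Prod.ext (comap_injective hmk (congrArg Prod.fst h1))
      (comap_injective hmk (congrArg Prod.snd h1)))
  · rintro ⟨⟨⟨f, g⟩, hr⟩, hx⟩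
    have h1 : f.comap π.symm = f := congrArg (fun z => z.1.1) hx
    have h2 : g.comap π.symm = g := congrArg (fun z => z.1.2) hx
    refine ⟨⟨(f.comap Quotient.out, g.comap Quotient.out), ?_⟩, ?_⟩
    · rw [← reduced_comap hmk, hlift f h1, hlift g h2]
      exact hr
    · exact Subtype.ext (Subtype.ext (Prod.ext (hlift f h1) (hlift g h2)))

end Stab

end TPre

namespace TPre

section Standard

variable {n : ℕ}

/-- The blocks are intervals, in increasing order. -/
def Std (f : TPre (Fin n)) : Prop := ∀ i j, i ≤ j → f.le i j

theorem exists_std_comap (f : TPre (Fin n)) : ∃ u : Equiv.Perm (Fin n), (f.comap u).Std := by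
  classical
  let r : Fin n → ℕ := fun a => (Finset.univ.filter fun c => f.le c a).card
  have hr : ∀ a b, r a ≤ r b → f.le a b := by
    intro a b h
    by_contra hab
    have hlt : r b < r a := by
      refine Finset.card_lt_card (Finset.ssubset_iff_of_subset ?_ |>.2 ⟨a, ?_, ?_⟩)
      · intro c hc
        simp only [Finset.mem_filter_univ] at hc ⊢
        exact f.trans _ _ _ hc (f.le_of_not_le hab)
      · simpa using f.refl a
      · simpa using hab
    omega
  exact ⟨Tuple.sort r, fun i j hij => hr _ _ (Tuple.monotone_sort r hij)⟩

theorem Std.mem_stab {f : TPre (Fin n)} (hf : f.Std) {w : Equiv.Perm (Fin n)}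
    (hw : (f.comap w).Std) : w ∈ stab f := by
  classical
  have key : ∀ b i, f.le (w i) b ↔ f.le i b := by
    intro b
    have hA : ∀ i j : Fin n, i ≤ j → f.le j b → f.le i b :=
      fun i j hij h => f.trans _ _ _ (hf i j hij) h
    have hB : ∀ i j : Fin n, i ≤ j → f.le (w j) b → f.le (w i) b :=
      fun i j hij h => f.trans _ _ _ (hw i j hij) h
    have hc : (Finset.univ.filter fun i => f.le (w i) b).card =
        (Finset.univ.filter fun i => f.le i b).card := by
      refine Finset.card_bij (fun i _ => w i) (by simp) (by simp) ?_
      intro c hc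
      exact ⟨w.symm c, by simpa using hc, by simp⟩
    have hsub : (Finset.univ.filter fun i => f.le (w i) b) ⊆
        (Finset.univ.filter fun i => f.le i b) ∨
        (Finset.univ.filter fun i => f.le i b) ⊆
        (Finset.univ.filter fun i => f.le (w i) b) := by
      by_contra! h
      obtain ⟨h1, h2⟩ := h
      obtain ⟨i, hi, hi'⟩ := Finset.not_subset.1 h1
      obtain ⟨j, hj, hj'⟩ := Finset.not_subset.1 h2
      simp only [Finset.mem_filter_univ] at hi hi' hj hj'
      rcases le_total i j with hij | hij
      · exact hi' (hA i j hij hj)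
      · exact hj' (hB j i hij hi)
    have heq : (Finset.univ.filter fun i => f.le (w i) b) =
        (Finset.univ.filter fun i => f.le i b) := by
      rcases hsub with h | h
      · exact Finset.eq_of_subset_of_card_le h hc.ge
      · exact (Finset.eq_of_subset_of_card_le h hc.le).symm
    intro i
    have := Finset.ext_iff.1 heq i
    simpa using this
  intro a
  exact ⟨(key (w a) a).1 (f.refl _), (key a a).2 (f.refl _)⟩

theorem Std.comap_eq {f : TPre (Fin n)} {u v : Equiv.Perm (Fin n)} (hu : (f.comap u).Std)
    (hv : (f.comap v).Std) : f.comap u = f.comap v := by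
  have h : ((f.comap u).comap (u⁻¹ * v : Equiv.Perm (Fin n))).Std := by
    rw [comap_comap]
    convert hv
    funext i
    simp
  rw [← comap_of_mem_stab (hu.mem_stab h), comap_comap]
  congr 1
  funext i
  simp

theorem Std.mul_inv_mem_stab {f : TPre (Fin n)} {u v : Equiv.Perm (Fin n)}
    (hu : (f.comap u).Std) (hv : (f.comap v).Std) : v * u⁻¹ ∈ stab f := by
  have h := hu.comap_eq hv
  refine mem_stab_of_comap ?_
  have h1 := congrArg (comap (u⁻¹ : Equiv.Perm (Fin n))) h
  rw [comap_comap, comap_comap] at h1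
  have h2 : f.comap (⇑u ∘ ⇑(u⁻¹ : Equiv.Perm (Fin n))) = f := by
    ext a b
    simp
  rw [h2] at h1
  exact h1.symm

theorem Std.std_iff {f : TPre (Fin n)} (hf : f.Std) {w : Equiv.Perm (Fin n)} :
    (f.comap w).Std ↔ w ∈ stab f :=
  ⟨hf.mem_stab, fun h => by rwa [comap_of_mem_stab h]⟩

/-- The adjacent transposition exchanging `i` and `i + 1`. -/
def adj (i : ℕ) (h : i + 1 < n) : Equiv.Perm (Fin n) :=
  Equiv.swap ⟨i, Nat.lt_of_succ_lt h⟩ ⟨i + 1, h⟩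

/-- The standard preorder whose blocks are the orbits of the parabolic subgroup of `I`. -/
def ofSimples (I : Set (Equiv.Perm (Fin n))) : TPre (Fin n) where
  le a b := ∀ i (h : i + 1 < n), b ≤ ⟨i, Nat.lt_of_succ_lt h⟩ → ⟨i + 1, h⟩ ≤ a → adj i h ∈ I
  total a b := by
    rcases le_total a b with h | h
    · left
      intro i hi h1 h2
      have := (h2.trans h).trans h1
      simp at this
    · right
      intro i hi h1 h2
      have := (h2.trans h).trans h1
      simp at this
  trans a b c h1 h2 i hi hc ha := by
    rcases le_or_gt b ⟨i, Nat.lt_of_succ_lt hi⟩ with hb | hb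
    · exact h1 i hi hb ha
    · exact h2 i hi hc (Nat.succ_le_of_lt hb)

theorem ofSimples_std (I : Set (Equiv.Perm (Fin n))) : (ofSimples I).Std := by
  intro a b h i hi h1 h2
  have := (h2.trans h).trans h1
  simp at this

theorem ofSimples_le_succ (I : Set (Equiv.Perm (Fin n))) (i : ℕ) (h : i + 1 < n) :
    (ofSimples I).le ⟨i + 1, h⟩ ⟨i, Nat.lt_of_succ_lt h⟩ ↔ adj i h ∈ I := by
  constructor
  · intro h'
    exact h' i h le_rfl le_rfl
  · intro h' j hj h1 h2
    simp only [Fin.mk_le_mk] at h1 h2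
    obtain rfl : j = i := by omega
    exact h'

theorem Std.ext {f g : TPre (Fin n)} (hf : f.Std) (hg : g.Std)
    (h : ∀ i (h : i + 1 < n), f.le ⟨i + 1, h⟩ ⟨i, Nat.lt_of_succ_lt h⟩ ↔
      g.le ⟨i + 1, h⟩ ⟨i, Nat.lt_of_succ_lt h⟩) : f = g := by
  have key : ∀ f g : TPre (Fin n), f.Std → g.Std →
      (∀ i (h : i + 1 < n), f.le ⟨i + 1, h⟩ ⟨i, Nat.lt_of_succ_lt h⟩ →
      g.le ⟨i + 1, h⟩ ⟨i, Nat.lt_of_succ_lt h⟩) → ∀ a b, f.le a b → g.le a b := by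
    intro f g hf hg h
    rintro ⟨a, ha⟩ ⟨b, hb⟩ hab
    induction a with
    | zero => exact hg _ _ (Nat.zero_le _)
    | succ a ih =>
      rcases Nat.lt_or_ge a b with h1 | h1
      · exact hg _ _ (Nat.succ_le_of_lt h1)
      · have h2 : f.le ⟨a, by omega⟩ ⟨b, hb⟩ :=
          f.trans _ _ _ (hf _ _ (by simp)) hab
        exact g.trans _ _ _ (h a ha (f.trans _ _ _ hab (hf _ _ h1))) (ih _ h2)
  ext a b
  exact ⟨key f g hf hg (fun i hi => (h i hi).1) a b, key g f hg hf (fun i hi => (h i hi).2) a b⟩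

theorem closure_eq_stab {I : Set (Equiv.Perm (Fin n))} (hI : I ⊆ simples n) :
    Subgroup.closure I = stab (ofSimples I) := by
  apply le_antisymm
  · rw [Subgroup.closure_le]
    intro s hs
    obtain ⟨i, hi, rfl⟩ := hI hs
    exact swap_mem_stab ⟨ofSimples_std I _ _ (by simp), (ofSimples_le_succ I i hi).2 hs⟩
  · intro w hw
    rw [mem_closure_isSwap]
    · refine ⟨Set.toFinite _, fun x => ?_⟩
      have key : ∀ b a : ℕ, ∀ (hb : b < n) (ha : a < n), b ≤ a →
          (ofSimples I).le ⟨a, ha⟩ ⟨b, hb⟩ →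
          (⟨a, ha⟩ : Fin n) ∈ MulAction.orbit (Subgroup.closure I) (⟨b, hb⟩ : Fin n) := by
        intro b a hb ha hab h
        induction a, hab using Nat.le_induction with
        | base => exact MulAction.mem_orbit_self _
        | succ a hab ih =>
          have h1 := ih (by omega) ((ofSimples I).trans _ _ _ (ofSimples_std I _ _ (by simp)) h)
          have h2 : adj a ha ∈ I := h a ha hab le_rfl
          rw [← MulAction.orbit_eq_iff.2 h1]
          refine ⟨⟨adj a ha, Subgroup.subset_closure h2⟩, ?_⟩
          change adj a ha ⟨a, _⟩ = _
          exact Equiv.swap_apply_left _ _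
      rcases le_total x (w x) with h | h
      · exact key _ _ _ _ h (hw x).2
      · exact MulAction.mem_orbit_symm.1 (key _ _ _ _ h (hw x).1)
    · intro s hs
      obtain ⟨i, hi, rfl⟩ := hI hs
      exact ⟨_, _, by simp, rfl⟩

end Standard

end TPre

namespace TPre

section DoubleCosets

variable {n : ℕ}

/-- The double coset attached to a pair of total preorders. -/
def dc (f g : TPre (Fin n)) : Set (Equiv.Perm (Fin n)) :=
  {d | ∃ u v : Equiv.Perm (Fin n), (f.comap u).Std ∧ (g.comap v).Std ∧ d = u⁻¹ * v}

theorem comap_symm_comap (f : TPre (Fin n)) (σ u : Equiv.Perm (Fin n)) :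
    (f.comap σ.symm).comap u = f.comap (σ⁻¹ * u : Equiv.Perm (Fin n)) := rfl

theorem dc_smul (σ : Equiv.Perm (Fin n)) (f g : TPre (Fin n)) :
    dc (f.comap σ.symm) (g.comap σ.symm) = dc f g := by
  ext d
  constructor
  · rintro ⟨u, v, hu, hv, rfl⟩
    exact ⟨σ⁻¹ * u, σ⁻¹ * v, hu, hv, by group⟩
  · rintro ⟨u, v, hu, hv, rfl⟩
    refine ⟨σ * u, σ * v, ?_, ?_, by group⟩
    · rwa [comap_symm_comap, inv_mul_cancel_left]
    · rwa [comap_symm_comap, inv_mul_cancel_left]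

theorem mem_dc_comm {f g : TPre (Fin n)} {d : Equiv.Perm (Fin n)} :
    d ∈ dc f g ↔ d⁻¹ ∈ dc g f := by
  constructor
  · rintro ⟨u, v, hu, hv, rfl⟩
    exact ⟨v, u, hv, hu, by group⟩
  · rintro ⟨u, v, hu, hv, h⟩
    refine ⟨v, u, hv, hu, ?_⟩
    rw [← inv_inv d, h]
    group

theorem dc_congr_symm {f g f' g' : TPre (Fin n)} (h : dc f g = dc f' g') :
    dc g f = dc g' f' := by
  ext d
  rw [mem_dc_comm, h, ← mem_dc_comm]

theorem mem_dc_iff {f g : TPre (Fin n)} (hf : f.Std) {d : Equiv.Perm (Fin n)} :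
    d ∈ dc f g ↔ ∃ k ∈ stab f, ∃ v : Equiv.Perm (Fin n), (g.comap v).Std ∧ d = k * v := by
  constructor
  · rintro ⟨u, v, hu, hv, rfl⟩
    exact ⟨u⁻¹, (stab f).inv_mem (hf.mem_stab hu), v, hv, rfl⟩
  · rintro ⟨k, hk, v, hv, rfl⟩
    refine ⟨k⁻¹, v, ?_, hv, by simp⟩
    exact hf.std_iff.2 ((stab f).inv_mem hk)

theorem doubleCoset_eq_dc {I J : Set (Equiv.Perm (Fin n))} (hI : I ⊆ simples n)
    (hJ : J ⊆ simples n) (w : Equiv.Perm (Fin n)) :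
    doubleCoset I w J = dc (ofSimples I) ((ofSimples J).comap w.symm) := by
  ext d
  rw [mem_dc_iff (ofSimples_std I)]
  simp only [doubleCoset, closure_eq_stab hI, closure_eq_stab hJ, Set.mem_ofPred_eq,
    comap_symm_comap, (ofSimples_std J).std_iff]
  constructor
  · rintro ⟨x, hx, y, hy, rfl⟩
    exact ⟨x, hx, w * y, by simpa using hy, by group⟩
  · rintro ⟨k, hk, v, hv, rfl⟩
    exact ⟨k, hk, w⁻¹ * v, hv, by group⟩

theorem exists_ofSimples_eq {f : TPre (Fin n)} (hf : f.Std) :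
    ∃ I ⊆ simples n, ofSimples I = f := by
  refine ⟨{s | ∃ (i : ℕ) (h : i + 1 < n), s = adj i h ∧
    f.le ⟨i + 1, h⟩ ⟨i, Nat.lt_of_succ_lt h⟩}, ?_, ?_⟩
  · rintro s ⟨i, h, rfl, -⟩
    exact ⟨i, h, rfl⟩
  · refine (ofSimples_std _).ext hf fun i h => ?_
    rw [ofSimples_le_succ]
    constructor
    · rintro ⟨j, hj, h1, h2⟩
      have h3 : (⟨j, Nat.lt_of_succ_lt hj⟩ : Fin n) = ⟨i, Nat.lt_of_succ_lt h⟩ := by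
        have h4 := congrArg (fun e : Equiv.Perm (Fin n) => e ⟨i, Nat.lt_of_succ_lt h⟩) h1
        simp only [adj, Equiv.swap_apply_left] at h4
        by_contra hne
        by_cases h5 : (⟨i, Nat.lt_of_succ_lt h⟩ : Fin n) = ⟨j + 1, hj⟩
        · rw [h5, Equiv.swap_apply_right] at h4
          simp only [Fin.mk.injEq] at h4 h5
          omega
        · rw [Equiv.swap_apply_of_ne_of_ne (Ne.symm hne) h5] at h4
          simp at h4
      simp only [Fin.mk.injEq] at h3
      subst h3
      exact h2
    · intro h'
      exact ⟨i, h, rfl, h'⟩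

theorem exists_doubleCoset_eq_dc (f g : TPre (Fin n)) :
    ∃ I ⊆ simples n, ∃ J ⊆ simples n, ∃ w : Equiv.Perm (Fin n), dc f g = doubleCoset I w J := by
  obtain ⟨u, hu⟩ := f.exists_std_comap
  obtain ⟨v, hv⟩ := g.exists_std_comap
  obtain ⟨I, hI, hIf⟩ := exists_ofSimples_eq hu
  obtain ⟨J, hJ, hJg⟩ := exists_ofSimples_eq hv
  refine ⟨I, hI, J, hJ, u⁻¹ * v, ?_⟩
  rw [doubleCoset_eq_dc hI hJ, hIf, hJg, ← dc_smul u⁻¹]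
  congr 1
  ext a b
  change _ ↔ g.le (v (v.symm (u a))) (v (v.symm (u b)))
  rw [Equiv.apply_symm_apply, Equiv.apply_symm_apply]
  exact Iff.rfl

theorem Cov.of_std {f : TPre (Fin n)} (hf : f.Std) {i : ℕ} (h : i + 1 < n)
    (h' : ¬ f.le ⟨i + 1, h⟩ ⟨i, Nat.lt_of_succ_lt h⟩) :
    f.Cov ⟨i, Nat.lt_of_succ_lt h⟩ ⟨i + 1, h⟩ := by
  refine ⟨h', fun c => ?_⟩
  rcases le_or_gt c ⟨i, Nat.lt_of_succ_lt h⟩ with hc | hc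
  · exact Or.inl (hf _ _ hc)
  · exact Or.inr (hf _ _ (Nat.succ_le_of_lt hc))

theorem eqv_of_swap_stable {f g : TPre (Fin n)} (hf : f.Std) {i j : Fin n}
    (hs : ∀ d ∈ dc f g, Equiv.swap i j * d ∈ dc f g) (hij : ¬ f.le j i)
    {a b : Fin n} (ha : f.Eqv a i) (hb : f.Eqv b j) : g.Eqv b a := by
  classical
  have hne : ∀ c d, f.Eqv c i → f.Eqv d j → ¬ f.Eqv c d :=
    fun c d hc hd h => hij ((hd.symm.trans (h.symm.trans hc)).1)
  have hs' : ∀ d ∈ dc f g, Equiv.swap a b * d ∈ dc f g := by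
    intro d hd
    set k : Equiv.Perm (Fin n) := Equiv.swap a i * Equiv.swap b j with hk
    have hkm : k ∈ stab f := (stab f).mul_mem (swap_mem_stab ha) (swap_mem_stab hb)
    have hka : k i = a := by
      have h1 : Equiv.swap b j i = i := by
        apply Equiv.swap_apply_of_ne_of_ne
        · rintro rfl; exact hne i i (Eqv.refl _ _) hb (Eqv.refl _ _)
        · rintro rfl; exact hne i i (Eqv.refl _ _) (Eqv.refl _ _) (Eqv.refl _ _)
      rw [hk, Equiv.Perm.mul_apply, h1, Equiv.swap_apply_right]
    have hkb : k j = b := by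
      rw [hk, Equiv.Perm.mul_apply, Equiv.swap_apply_right, Equiv.swap_apply_of_ne_of_ne]
      · rintro rfl; exact hne b b ha hb (Eqv.refl _ _)
      · rintro rfl; exact hne b b (Eqv.refl _ _) hb (Eqv.refl _ _)
    have hconj : Equiv.swap a b = k * Equiv.swap i j * k⁻¹ := by
      rw [← hka, ← hkb]
      exact Equiv.swap_apply_apply k i j
    have hst : ∀ k ∈ stab f, ∀ d ∈ dc f g, k * d ∈ dc f g := by
      intro k hk d hd
      obtain ⟨k', hk', v, hv, rfl⟩ := (mem_dc_iff hf).1 hd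
      exact (mem_dc_iff hf).2 ⟨k * k', (stab f).mul_mem hk hk', v, hv, by group⟩
    rw [hconj, mul_assoc, mul_assoc]
    exact hst _ hkm _ (hs _ (hst _ ((stab f).inv_mem hkm) _ hd))
  obtain ⟨v, hv⟩ := g.exists_std_comap
  have hvd : v ∈ dc f g := (mem_dc_iff hf).2 ⟨1, (stab f).one_mem, v, hv, by simp⟩
  obtain ⟨k, hk, v', hv', he⟩ := (mem_dc_iff hf).1 (hs' v hvd)
  have hr : k⁻¹ * Equiv.swap a b ∈ stab g := by
    have h1 := hv.mul_inv_mem_stab hv'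
    have h2 : v' = k⁻¹ * (Equiv.swap a b * v) := by rw [he]; group
    rw [h2] at h1
    convert h1 using 1
    group
  set r := k⁻¹ * Equiv.swap a b with hrdef
  by_contra hab
  have hki := (stab f).inv_mem hk
  have hrf : ∀ c, f.Eqv (r c) (Equiv.swap a b c) := fun c => (hki _).symm
  set A := Finset.univ.filter fun c => f.Eqv c i ∧ g.Eqv c a with hA
  have hmaps : (A.image r.symm) ⊆ A.erase a := by
    intro c hc
    obtain ⟨d, hd, rfl⟩ := Finset.mem_image.1 hc
    obtain ⟨h1, h2⟩ := (Finset.mem_filter_univ _).1 hd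
    set c := r.symm d with hcd
    have hrc : r c = d := by simp [hcd]
    have h3 : g.Eqv c a := by
      have := hr c
      rw [hrc] at this
      exact this.trans h2
    have h4 : f.Eqv (Equiv.swap a b c) i := by
      have := hrf c
      rw [hrc] at this
      exact this.symm.trans h1
    have hca : c ≠ a := by
      intro h
      rw [h, Equiv.swap_apply_left] at h4
      exact hne b b h4 hb (Eqv.refl _ _)
    have hcb : c ≠ b := by
      intro h
      rw [h] at h3
      exact hab h3
    rw [Equiv.swap_apply_of_ne_of_ne hca hcb] at h4
    exact Finset.mem_erase.2 ⟨hca, (Finset.mem_filter_univ _).2 ⟨h4, h3⟩⟩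
  have haA : a ∈ A := (Finset.mem_filter_univ _).2 ⟨ha, Eqv.refl _ _⟩
  have h1 := Finset.card_le_card hmaps
  rw [Finset.card_image_of_injective _ r.symm.injective] at h1
  exact absurd h1 (not_le.2 (Finset.card_erase_lt_of_mem haA))

theorem le_succ_iff_of_noMerge {f g : TPre (Fin n)} (hf : f.Std) (h : NoMerge f g) {i : ℕ}
    (hi : i + 1 < n) : f.le ⟨i + 1, hi⟩ ⟨i, Nat.lt_of_succ_lt hi⟩ ↔
      ∀ d ∈ dc f g, adj i hi * d ∈ dc f g := by
  constructor
  · intro h1 d hd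
    obtain ⟨k, hk, v, hv, rfl⟩ := (mem_dc_iff hf).1 hd
    have h2 : adj i hi ∈ stab f := swap_mem_stab ⟨hf _ _ (by simp), h1⟩
    exact (mem_dc_iff hf).2 ⟨_, (stab f).mul_mem h2 hk, v, hv, by group⟩
  · intro hs
    by_contra hij
    refine h ⟨_, _, Cov.of_std hf hi hij, ?_⟩
    rintro z (hz | hz)
    · exact (eqv_of_swap_stable hf hs hij hz (Eqv.refl _ _)).symm.trans
        (eqv_of_swap_stable hf hs hij (Eqv.refl _ _) (Eqv.refl _ _))
    · exact eqv_of_swap_stable hf hs hij (Eqv.refl _ _) hz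

theorem comap_eq_of_dc_eq {f g f' g' : TPre (Fin n)} (h : NoMerge f g) (h' : NoMerge f' g')
    (hd : dc f g = dc f' g') {u u' : Equiv.Perm (Fin n)} (hu : (f.comap u).Std)
    (hu' : (f'.comap u').Std) : f.comap u = f'.comap u' := by
  refine hu.ext hu' fun i hi => ?_
  rw [le_succ_iff_of_noMerge hu ((noMerge_comap u.surjective f g).2 h),
    le_succ_iff_of_noMerge hu' ((noMerge_comap u'.surjective f' g').2 h')]
  have e1 := dc_smul u⁻¹ f g
  have e2 := dc_smul u'⁻¹ f' g'
  change dc (f.comap u) (g.comap u) = _ at e1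
  change dc (f'.comap u') (g'.comap u') = _ at e2
  rw [e1, e2, hd]

theorem exists_smul_eq_of_dc_eq (x y : RedPair (Fin n))
    (hd : dc x.1.1 x.1.2 = dc y.1.1 y.1.2) : ∃ σ : Equiv.Perm (Fin n), σ • x = y := by
  obtain ⟨⟨f, g⟩, hr⟩ := x
  obtain ⟨⟨f', g'⟩, hr'⟩ := y
  dsimp only at hd hr hr'
  obtain ⟨u, hu⟩ := f.exists_std_comap
  obtain ⟨v, hv⟩ := g.exists_std_comap
  have h1 : u⁻¹ * v ∈ dc f' g' := hd ▸ ⟨u, v, hu, hv, rfl⟩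
  obtain ⟨u', v', hu', hv', he⟩ := h1
  have ef := comap_eq_of_dc_eq hr.1 hr'.1 hd hu hu'
  have eg := comap_eq_of_dc_eq hr.2 hr'.2 (dc_congr_symm hd) hv hv'
  have he' : u' * u⁻¹ = v' * v⁻¹ := by
    calc u' * u⁻¹ = u' * (u⁻¹ * v) * v⁻¹ := by group
      _ = v' * v⁻¹ := by rw [he]; group
  have key : ∀ {f f' : TPre (Fin n)} {u u' : Equiv.Perm (Fin n)}, f.comap u = f'.comap u' →
      f.comap (u' * u⁻¹ : Equiv.Perm (Fin n)).symm = f' := by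
    intro f f' u u' h
    ext a b
    have := congrArg (fun h => h.le (u'.symm a) (u'.symm b)) h
    simp only [comap_le, Equiv.apply_symm_apply, eq_iff_iff] at this
    exact this
  refine ⟨u' * u⁻¹, Subtype.ext (Prod.ext (key ef) ?_)⟩
  have := key eg
  rw [← he'] at this
  exact this

end DoubleCosets

end TPre

namespace TPre

section Merge

variable {α : Type*}

/-- Merge all blocks between those of `p` and `q`. -/
def merge (f : TPre α) (p q : α) : TPre α where
  le a b := f.le a b ∨ (f.le a q ∧ f.le p b)
  total a b := by
    rcases f.total a b with h | h
    · exact Or.inl (Or.inl h)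
    · exact Or.inr (Or.inl h)
  trans a b c := by
    rintro (h1 | ⟨h1, h2⟩) (h3 | ⟨h3, h4⟩)
    · exact Or.inl (f.trans _ _ _ h1 h3)
    · exact Or.inr ⟨f.trans _ _ _ h1 h3, h4⟩
    · exact Or.inr ⟨h1, f.trans _ _ _ h2 h3⟩
    · exact Or.inr ⟨h1, h4⟩

variable {n : ℕ}

theorem dc_merge_of_std {f g : TPre (Fin n)} (hf : f.Std) {p q : Fin n} (hpq : f.Cov p q)
    (hg : ∀ z, f.Eqv z p ∨ f.Eqv z q → g.Eqv z p) : dc (f.merge p q) g = dc f g := by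
  classical
  have hf' : (f.merge p q).Std := fun i j h => Or.inl (hf i j h)
  ext d
  rw [mem_dc_iff hf, mem_dc_iff hf']
  constructor
  · rintro ⟨k, hk, v, hv, rfl⟩
    have hM : ∀ z, (f.le p z ∧ f.le z q) ↔ (f.le p (k z) ∧ f.le (k z) q) := by
      intro z
      have h1 := hk z
      constructor
      · rintro ⟨h2, h3⟩
        refine ⟨?_, ?_⟩
        · rcases h1.1 with h | h
          exacts [f.trans _ _ _ h2 h, h.2]
        · rcases h1.2 with h | h
          exacts [f.trans _ _ _ h h3, h.1]
      · rintro ⟨h2, h3⟩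
        refine ⟨?_, ?_⟩
        · rcases h1.2 with h | h
          exacts [f.trans _ _ _ h2 h, h.2]
        · rcases h1.1 with h | h
          exacts [f.trans _ _ _ h h3, h.1]
    have hMg : ∀ z, (f.le p z ∧ f.le z q) → g.Eqv z p := by
      rintro z ⟨h1, h2⟩
      rcases hpq.2 z with h | h
      · exact hg z (Or.inl ⟨h, h1⟩)
      · exact hg z (Or.inr ⟨h2, h⟩)
    set w : Equiv.Perm (Fin n) := Equiv.Perm.ofSubtype
      (k.subtypePerm (p := fun z => f.le p z ∧ f.le z q) fun z => (hM z).symm) with hw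
    have hw1 : ∀ z, (f.le p z ∧ f.le z q) → w z = k z := by
      intro z hz
      exact Equiv.Perm.ofSubtype_apply_of_mem (p := fun z => f.le p z ∧ f.le z q) _ hz
    have hw2 : ∀ z, ¬ (f.le p z ∧ f.le z q) → w z = z := by
      intro z hz
      exact Equiv.Perm.ofSubtype_apply_of_not_mem (p := fun z => f.le p z ∧ f.le z q) _ hz
    have hwg : w ∈ stab g := by
      intro z
      by_cases hz : f.le p z ∧ f.le z q
      · rw [hw1 z hz]
        exact (hMg z hz).trans (hMg _ ((hM z).1 hz)).symm
      · rw [hw2 z hz]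
        exact Eqv.refl _ _
    have hkw : k * w⁻¹ ∈ stab f := by
      intro a
      obtain ⟨z, rfl⟩ := w.surjective a
      have : (k * w⁻¹) (w z) = k z := by simp
      rw [this]
      by_cases hz : f.le p z ∧ f.le z q
      · rw [hw1 z hz]
        exact Eqv.refl _ _
      · rw [hw2 z hz]
        have h1 := hk z
        constructor
        · rcases h1.1 with h | ⟨h2, h3⟩
          · exact h
          · exact f.trans _ _ _ (f.le_of_not_le fun h => hz ⟨h, h2⟩) h3
        · rcases h1.2 with h | ⟨h2, h3⟩
          · exact h
          · exact f.trans _ _ _ h2 (f.le_of_not_le fun h => hz ⟨h3, h⟩)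
    refine ⟨_, hkw, w * v, ?_, by group⟩
    have : g.comap (w * v : Equiv.Perm (Fin n)) = (g.comap w).comap v := rfl
    rwa [this, comap_of_mem_stab hwg]
  · rintro ⟨k, hk, v, hv, rfl⟩
    exact ⟨k, fun a => ⟨Or.inl (hk a).1, Or.inl (hk a).2⟩, v, hv, rfl⟩

theorem dc_merge {f g : TPre (Fin n)} {p q : Fin n} (hpq : f.Cov p q)
    (hg : ∀ z, f.Eqv z p ∨ f.Eqv z q → g.Eqv z p) : dc (f.merge p q) g = dc f g := by
  obtain ⟨u, hu⟩ := f.exists_std_comap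
  have e : ∀ f g : TPre (Fin n), dc (f.comap u) (g.comap u) = dc f g := fun f g => dc_smul u⁻¹ f g
  rw [← e (f.merge p q), ← e f]
  have h1 : (f.merge p q).comap u = (f.comap u).merge (u.symm p) (u.symm q) := by
    ext a b
    simp [merge]
  rw [h1]
  apply dc_merge_of_std hu
  · rw [comap_cov u.surjective]
    simpa using hpq
  · intro z hz
    simp only [comap_eqv, Equiv.apply_symm_apply] at hz ⊢
    exact hg _ hz

theorem ncard_merge_lt [Finite α] {f : TPre α} {p q : α} (hpq : f.Cov p q) :
    {x : α × α | f.le x.1 x.2}.ncard < {x : α × α | (f.merge p q).le x.1 x.2}.ncard := by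
  refine Set.ncard_lt_ncard ?_ (Set.toFinite _)
  refine ⟨fun x hx => Or.inl hx, fun h => ?_⟩
  exact hpq.1 (h (show (q, p) ∈ {x : α × α | (f.merge p q).le x.1 x.2} from
    Or.inr ⟨f.refl _, f.refl _⟩))

theorem exists_redPair (f g : TPre (Fin n)) :
    ∃ x : RedPair (Fin n), dc x.1.1 x.1.2 = dc f g := by
  have : Nonempty {x : TPre (Fin n) × TPre (Fin n) // dc x.1 x.2 = dc f g} := ⟨⟨(f, g), rfl⟩⟩
  obtain ⟨⟨⟨f', g'⟩, he⟩, hmax⟩ := Finite.exists_max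
    (fun x : {x : TPre (Fin n) × TPre (Fin n) // dc x.1 x.2 = dc f g} =>
      {y : Fin n × Fin n | x.1.1.le y.1 y.2}.ncard + {y : Fin n × Fin n | x.1.2.le y.1 y.2}.ncard)
  refine ⟨⟨(f', g'), ?_, ?_⟩, he⟩
  · rintro ⟨p, q, h1, h2⟩
    have h3 := hmax ⟨(f'.merge p q, g'), (dc_merge h1 h2).trans he⟩
    have h4 := ncard_merge_lt h1
    dsimp only at h3 h4
    omega
  · rintro ⟨p, q, h1, h2⟩
    have h3 := hmax ⟨(f', g'.merge p q), (dc_congr_symm (dc_merge h1 h2)).trans he⟩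
    have h4 := ncard_merge_lt h1
    dsimp only at h3 h4
    omega

theorem pdcCount_eq (n : ℕ) :
    pdcCount n = Nat.card (MulAction.orbitRel.Quotient (Equiv.Perm (Fin n)) (RedPair (Fin n))) := by
  symm
  let φ : RedPair (Fin n) → {C : Set (Equiv.Perm (Fin n)) //
      ∃ I ⊆ simples n, ∃ J ⊆ simples n, ∃ w : Equiv.Perm (Fin n), C = doubleCoset I w J} :=
    fun x => ⟨dc x.1.1 x.1.2, exists_doubleCoset_eq_dc _ _⟩
  have hφ : ∀ x y : RedPair (Fin n), (MulAction.orbitRel (Equiv.Perm (Fin n)) _) x y →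
      φ x = φ y := by
    rintro x y ⟨σ, rfl⟩
    exact Subtype.ext (dc_smul σ y.1.1 y.1.2)
  refine Nat.card_congr (Equiv.ofBijective (Quotient.lift φ hφ) ⟨?_, ?_⟩)
  · rintro ⟨x⟩ ⟨y⟩ h
    obtain ⟨σ, hσ⟩ := exists_smul_eq_of_dc_eq y x (congrArg Subtype.val h).symm
    exact Quotient.sound ⟨σ, hσ⟩
  · rintro ⟨C, I, hI, J, hJ, w, rfl⟩
    obtain ⟨x, hx⟩ := exists_redPair (ofSimples I) ((ofSimples J).comap w.symm)
    exact ⟨Quotient.mk _ x, Subtype.ext (hx.trans (doubleCoset_eq_dc hI hJ w).symm)⟩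

theorem pdcCount_mul_factorial (n : ℕ) :
    (pdcCount n : ℝ) * n.factorial =
      ∑ j ∈ Finset.range (n + 1), (cycNum n j : ℝ) * red (n - j) := by
  classical
  rw [← sum_cyc n fun k => (red k : ℝ)]
  have : Fintype (RedPair (Fin n)) := Fintype.ofFinite _
  have h := MulAction.sum_card_fixedBy_eq_card_orbits_mul_card_group (Equiv.Perm (Fin n))
    (RedPair (Fin n))
  rw [← Nat.card_eq_fintype_card (α := Quotient _)] at h
  simp only [← Nat.card_eq_fintype_card, card_fixedBy] at h
  rw [Nat.card_perm, Nat.card_fin] at h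
  rw [pdcCount_eq]
  exact_mod_cast h.symm

end Merge

end TPre

namespace TPre

section Agree

variable {α : Type*}

/-- Two preorders have the same restriction to `S`. -/
def AgreeOn (S : Set α) (f g : TPre α) : Prop := ∀ a ∈ S, ∀ b ∈ S, f.le a b ↔ g.le a b

theorem AgreeOn.eq {f g : TPre α} (h : AgreeOn Set.univ f g) : f = g := by
  ext a b
  exact h a trivial b trivial

theorem agreeOn_iff {S : Set α} {f g : TPre α} :
    AgreeOn S f g ↔ f.comap (Subtype.val : S → α) = g.comap Subtype.val := by
  constructor
  · intro h
    ext a b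
    exact h a a.2 b b.2
  · intro h a ha b hb
    exact iff_of_eq (congrArg (fun k => k.le ⟨a, ha⟩ ⟨b, hb⟩) h)

theorem AgreeOn.extend {S : Set α} {f g : TPre α} (h : AgreeOn S f g) {d : α}
    (h1 : ∀ a ∈ S, f.le a d ↔ g.le a d) (h2 : ∀ a ∈ S, f.le d a ↔ g.le d a) :
    AgreeOn (insert d S) f g := by
  rintro a (rfl | ha) b (rfl | hb)
  · exact iff_of_true (f.refl _) (g.refl _)
  · exact h2 b hb
  · exact h1 a ha
  · exact h a ha b hb

theorem AgreeOn.extend_of_eqv {S : Set α} {f g : TPre α} (h : AgreeOn S f g) {c d : α}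
    (hc : c ∈ S) (hf : f.Eqv c d) (hg : g.Eqv c d) : AgreeOn (insert d S) f g := by
  have key : ∀ k : TPre α, k.Eqv c d → ∀ a, (k.le a d ↔ k.le a c) ∧ (k.le d a ↔ k.le c a) :=
    fun k hk a => ⟨⟨fun h => k.trans _ _ _ h hk.2, fun h => k.trans _ _ _ h hk.1⟩,
      ⟨fun h => k.trans _ _ _ hk.1 h, fun h => k.trans _ _ _ hk.2 h⟩⟩
  refine h.extend (fun a ha => ?_) fun a ha => ?_
  · rw [(key f hf a).1, (key g hg a).1, h a ha c hc]
  · rw [(key f hf a).2, (key g hg a).2, h c hc a ha]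

theorem AgreeOn.extend_of_cov {S : Set α} {f g : TPre α} (h : AgreeOn S f g) {c d : α}
    (hc : c ∈ S) (hf : f.Cov c d) (hg : g.Cov c d)
    (hfg : (∃ b ∈ S, f.Eqv b d) ↔ ∃ b ∈ S, g.Eqv b d) : AgreeOn (insert d S) f g := by
  have key1 : ∀ k : TPre α, k.Cov c d → ∀ a, k.le d a ↔ ¬ k.le a c :=
    fun k hk a => ⟨fun h h' => hk.1 (k.trans _ _ _ h h'), fun h => (hk.2 a).resolve_left h⟩
  have key2 : ∀ k : TPre α, k.Cov c d → ∀ a ∈ S, k.le a d ↔ k.le a c ∨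
      (∃ b ∈ S, k.Eqv b d) ∧ ∀ b ∈ S, ¬ k.le b c → k.le a b := by
    intro k hk a ha
    constructor
    · intro h1
      by_cases h2 : k.le a c
      · exact Or.inl h2
      · refine Or.inr ⟨⟨a, ha, h1, (key1 k hk a).2 h2⟩, fun b hb h3 => ?_⟩
        exact k.trans _ _ _ h1 ((key1 k hk b).2 h3)
    · rintro (h1 | ⟨⟨b, hb, hbd⟩, h1⟩)
      · exact k.trans _ _ _ h1 (k.le_of_not_le hk.1)
      · exact k.trans _ _ _ (h1 b hb fun h => hk.1 (k.trans _ _ _ hbd.2 h)) hbd.1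
  refine h.extend (fun a ha => ?_) fun a ha => ?_
  · rw [key2 f hf a ha, key2 g hg a ha, h a ha c hc, hfg]
    refine or_congr_right (and_congr_right fun _ => ?_)
    refine forall₂_congr fun b hb => ?_
    rw [h b hb c hc, h a ha b hb]
  · rw [key1 f hf, key1 g hg, h a ha c hc]

theorem AgreeOn.extend_of_cov_single {S : Set α} {f g : TPre α} (h : AgreeOn S f g) {c d : α}
    (hc : c ∈ S) (hd : d ∉ S) (hf : f.Cov c d) (hg : g.Cov c d) (hf' : f.Single d)
    (hg' : g.Single d) : AgreeOn (insert d S) f g := by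
  refine h.extend_of_cov hc hf hg (iff_of_false ?_ ?_)
  · rintro ⟨b, hb, h1⟩
    exact hd (hf' b h1.symm ▸ hb)
  · rintro ⟨b, hb, h1⟩
    exact hd (hg' b h1.symm ▸ hb)

theorem card_le_fub_mul [Finite α] {κ : Type*} [Finite κ] (X : Set (TPre α)) (S : Set α)
    (φ : TPre α → κ) (h : ∀ f ∈ X, ∀ g ∈ X, AgreeOn S f g → φ f = φ g → f = g) :
    X.ncard ≤ fub S.ncard * Nat.card κ := by
  have h1 : Nat.card X ≤ Nat.card (TPre S × κ) := by
    refine Nat.card_le_card_of_injective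
      (fun f : X => ((f : TPre α).comap (Subtype.val : S → α), φ f)) ?_
    rintro ⟨f, hf⟩ ⟨g, hg⟩ he
    have h2 := Prod.ext_iff.1 he
    exact Subtype.ext (h f hf g hg (agreeOn_iff.2 h2.1) h2.2)
  rwa [Nat.card_prod, card_eq_fub, Nat.card_coe_set_eq, Nat.card_coe_set_eq] at h1

theorem card_le_fub [Finite α] (X : Set (TPre α)) (S : Set α)
    (h : ∀ f ∈ X, ∀ g ∈ X, AgreeOn S f g → f = g) :
    X.ncard ≤ fub S.ncard := by
  have := card_le_fub_mul X S (fun _ => ()) fun f hf g hg hfg _ => h f hf g hg hfg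
  simpa using this

end Agree

section Lex

variable {α β : Type*}

/-- Break ties of `f` according to `lev`. -/
def lex (f : TPre α) (lev : α → Prop) : TPre α where
  le a b := f.le a b ∧ (f.le b a → lev a → lev b)
  total a b := by
    by_cases ha : lev a <;> by_cases hb : lev b <;> rcases f.total a b with h | h <;>
      by_cases h' : f.le a b <;> by_cases h'' : f.le b a <;> tauto
  trans a b c h1 h2 := by
    refine ⟨f.trans _ _ _ h1.1 h2.1, fun h ha => ?_⟩
    exact h2.2 (f.trans _ _ _ h h1.1) (h1.2 (f.trans _ _ _ h2.1 h) ha)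

theorem lex_le {f : TPre α} {lev : α → Prop} {a b : α} :
    (f.lex lev).le a b ↔ f.le a b ∧ (f.le b a → lev a → lev b) := Iff.rfl

theorem lex_eqv {f : TPre α} {lev : α → Prop} {a b : α} :
    (f.lex lev).Eqv a b ↔ f.Eqv a b ∧ (lev a ↔ lev b) := by
  unfold Eqv
  rw [lex_le, lex_le]
  tauto

/-- Join the isolated point `p` to the block preceding it. -/
def joinPrev (f : TPre α) (p : α) (hp : f.Single p) : TPre α where
  le a b := f.le a b ∨ a = p ∧ f.Cov b p
  total a b := (f.total a b).imp Or.inl Or.inl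
  trans a b c := by
    rintro (h1 | ⟨rfl, h1⟩) (h2 | ⟨rfl, h2⟩)
    · exact Or.inl (f.trans _ _ _ h1 h2)
    · rcases h2.2 a with h | h
      · exact Or.inl h
      · exact Or.inr ⟨hp a ⟨h, h1⟩, h2⟩
    · rcases h1.2 c with h | h
      · refine Or.inr ⟨rfl, fun h' => h1.1 (f.trans _ _ _ h' h), fun d => ?_⟩
        exact (h1.2 d).imp_left fun h' => f.trans _ _ _ h' h2
      · exact Or.inl h
    · exact absurd (f.refl _) h1.1

theorem joinPrev_le {f : TPre α} {p : α} {hp : f.Single p} {a b : α} :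
    (f.joinPrev p hp).le a b ↔ f.le a b ∨ a = p ∧ f.Cov b p := Iff.rfl

end Lex

end TPre

namespace TPre

section SingleCount

variable {α : Type*}

theorem lex_injOn (p : α) :
    Set.InjOn (fun f : TPre α => f.lex (· = p)) {f | ¬ f.Single p} := by
  intro f hf g hg h
  simp only [Set.mem_ofPred_eq, Single, not_forall] at hf hg
  obtain ⟨c, hc, hcp⟩ := hf
  obtain ⟨c', hc', hcp'⟩ := hg
  have h1 : ∀ a b, a ≠ p → (f.le a b ↔ g.le a b) := by
    intro a b ha
    have := iff_of_eq (congrArg (fun k : TPre α => k.le a b) h)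
    simpa [lex_le, ha] using this
  have h2 : ∀ b, f.le p b ↔ g.le p b := by
    intro b
    constructor
    · intro hb
      have h3 : g.le c' c := (h1 c' c hcp').1
        (f.trans _ _ _ ((h1 c' p hcp').2 hc'.2) hc.1)
      exact g.trans _ _ _ (g.trans _ _ _ hc'.1 h3) ((h1 c b hcp).1 (f.trans _ _ _ hc.2 hb))
    · intro hb
      have h3 : f.le c c' := (h1 c c' hcp).2
        (g.trans _ _ _ ((h1 c p hcp).1 hc.2) hc'.1)
      exact f.trans _ _ _ (f.trans _ _ _ hc.1 h3) ((h1 c' b hcp').2 (g.trans _ _ _ hc'.2 hb))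
  ext a b
  by_cases ha : a = p
  · exact ha ▸ h2 b
  · exact h1 a b ha

theorem exists_cov [Finite α] (f : TPre α) (p : α) (h : ∃ b, ¬ f.le p b) : ∃ b, f.Cov b p := by
  by_contra! h1
  obtain ⟨b, hb⟩ := h
  have : WellFounded fun a b : α => ¬ f.le a b := by
    have : IsTrans α fun a b => ¬ f.le a b :=
      ⟨fun a b c h1 h2 h3 => h1 (f.trans _ _ _ h3 (f.le_of_not_le h2))⟩
    have : Std.Irrefl fun a b : α => ¬ f.le a b := ⟨fun a h => h (f.refl a)⟩
    exact Finite.wellFounded_of_trans_of_irrefl _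
  obtain ⟨m, hm, hm'⟩ := this.has_min {b | ¬ f.le p b} ⟨b, hb⟩
  refine h1 m ⟨hm, fun c => ?_⟩
  by_contra! h2
  exact hm' c h2.2 h2.1

theorem insert_compl_singleton (p : α) : insert p ({p}ᶜ : Set α) = Set.univ := by
  ext a
  simp [em]

variable [Finite α]

theorem ncard_single_bot_le (p : α) :
    {f : TPre α | f.Single p ∧ ∀ b, f.le p b}.ncard ≤ fub (Nat.card α - 1) := by
  have h0 : ({p}ᶜ : Set α).ncard = Nat.card α - 1 := by
    rw [Set.ncard_compl, Set.ncard_singleton]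
  rw [← h0]
  refine card_le_fub _ _ fun f hf g hg h => AgreeOn.eq ?_
  have := h.extend (d := p)
    (fun a ha => iff_of_false (fun h => ha (hf.1 a ⟨hf.2 a, h⟩)) (fun h => ha (hg.1 a ⟨hg.2 a, h⟩)))
    (fun a _ => iff_of_true (hf.2 a) (hg.2 a))
  rwa [insert_compl_singleton] at this

theorem ncard_single_cov_le {p d : α} :
    {f : TPre α | f.Single p ∧ f.Cov d p}.ncard ≤ fub (Nat.card α - 1) := by
  by_cases hd : d = p
  · convert Nat.zero_le _
    rw [Set.ncard_eq_zero]
    ext f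
    simp only [Set.mem_ofPred_eq, Set.mem_empty_iff_false, iff_false]
    rintro ⟨-, h⟩
    exact h.1 (hd ▸ f.refl _)
  have h0 : ({p}ᶜ : Set α).ncard = Nat.card α - 1 := by
    rw [Set.ncard_compl, Set.ncard_singleton]
  rw [← h0]
  refine card_le_fub _ _ fun f hf g hg h => AgreeOn.eq ?_
  have := h.extend_of_cov_single (c := d) (d := p) hd (by simp) hf.2 hg.2 hf.1 hg.1
  rwa [insert_compl_singleton] at this

/-- The number of total preorders in which all points of `D` are isolated. -/
noncomputable def singleCount (D : Finset α) : ℕ := {f : TPre α | ∀ d ∈ D, f.Single d}.ncard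

theorem singleCount_empty : singleCount (∅ : Finset α) = fub (Nat.card α) := by
  simp [singleCount, card_eq_fub]

theorem singleCount_insert [DecidableEq α] (D : Finset α) {p : α} (hp : p ∉ D) :
    2 * singleCount (insert p D) ≤ singleCount D + (D.card + 1) * fub (Nat.card α - 1) ∧
      singleCount D ≤ 2 * singleCount (insert p D) := by
  set A := {f : TPre α | (∀ d ∈ D, f.Single d) ∧ ¬ f.Single p} with hA
  set B := {f : TPre α | ∀ d ∈ insert p D, f.Single d} with hB
  have h0 : singleCount D = A.ncard + B.ncard := by
    rw [← Set.ncard_union_eq]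
    · unfold singleCount
      congr 1
      ext f
      simp only [hA, hB, Set.mem_ofPred_eq, Set.mem_union, Finset.mem_insert, forall_eq_or_imp]
      tauto
    · rw [Set.disjoint_left]
      intro f h1 h2
      exact h1.2 (h2 p (Finset.mem_insert_self _ _))
  have h1 : A.ncard ≤ B.ncard := by
    refine Set.ncard_le_ncard_of_injOn (fun f : TPre α => f.lex (· = p)) ?_
      ((lex_injOn p).mono fun f hf => hf.2)
    intro f hf d hd b hb
    rw [lex_eqv] at hb
    rcases Finset.mem_insert.1 hd with rfl | hd
    · exact hb.2.1 rfl
    · exact hf.1 d hd b hb.1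
  set E : Set (TPre α) := {f | f.Single p ∧ ∀ b, f.le p b} ∪
    ⋃ d ∈ D, {f | f.Single p ∧ f.Cov d p} with hE
  have h2 : E.ncard ≤ (D.card + 1) * fub (Nat.card α - 1) := by
    refine (Set.ncard_union_le _ _).trans ?_
    have := Finset.set_ncard_biUnion_le D fun d => {f : TPre α | f.Single p ∧ f.Cov d p}
    have h3 : ∑ d ∈ D, {f : TPre α | f.Single p ∧ f.Cov d p}.ncard ≤
        ∑ d ∈ D, fub (Nat.card α - 1) := Finset.sum_le_sum fun d _ => ncard_single_cov_le
    rw [Finset.sum_const, smul_eq_mul] at h3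
    have h4 := ncard_single_bot_le p
    linarith
  have h3 : (B \ E).ncard ≤ A.ncard := by
    have hs : ∀ f ∈ B, f.Single p := fun f hf => hf p (Finset.mem_insert_self _ _)
    refine Set.ncard_le_ncard_of_injOn
      (fun f : TPre α => open Classical in if h : f.Single p then f.joinPrev p h else f) ?_ ?_
    · intro f hf
      have hfp := hs f hf.1
      simp only [hfp, dif_pos]
      have hE' := hf.2
      simp only [hE, Set.mem_union, Set.mem_ofPred_eq, Set.mem_iUnion, not_or, not_and,
        not_exists] at hE'
      obtain ⟨b, hb⟩ := exists_cov f p (by simpa using hE'.1 hfp)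
      constructor
      · intro d hd c hc
        have hdp : d ≠ p := fun h => hp (h ▸ hd)
        rcases hc with ⟨h4 | h4, h5 | h5⟩
        · exact hf.1 d (Finset.mem_insert_of_mem hd) c ⟨h4, h5⟩
        · exact absurd h5.2 (hE'.2 d hd hfp)
        · exact absurd h4.1 hdp
        · exact absurd h4.1 hdp
      · intro h4
        have := h4 b ⟨Or.inr ⟨rfl, hb⟩, Or.inl (f.le_of_not_le hb.1)⟩
        exact hb.1 (this ▸ f.refl _)
    · intro f hf g hg h
      have hfp := hs f hf.1
      have hgp := hs g hg.1
      simp only [hfp, hgp, dif_pos] at h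
      have h4 : ∀ a b, a ≠ p → (f.le a b ↔ g.le a b) := by
        intro a b ha
        have := iff_of_eq (congrArg (fun k : TPre α => k.le a b) h)
        simpa [joinPrev_le, ha] using this
      have h5 : ∀ k : TPre α, k.Single p → ∀ a, a ≠ p → (k.le p a ↔ ¬ k.le a p) :=
        fun k hk a ha => ⟨fun h h' => ha (hk a ⟨h, h'⟩), k.le_of_not_le⟩
      ext a b
      by_cases ha : a = p
      · subst ha
        by_cases hb : b = a
        · subst hb; exact iff_of_true (f.refl _) (g.refl _)
        · rw [h5 f hfp b hb, h5 g hgp b hb, h4 b a hb]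
      · exact h4 a b ha
  have h4 : B.ncard ≤ (B \ E).ncard + E.ncard := Set.ncard_le_ncard_sdiff_add_ncard B E
  change 2 * B.ncard ≤ _ ∧ _ ≤ 2 * B.ncard
  omega

theorem abs_two_pow_mul_singleCount_sub_le [DecidableEq α] (D : Finset α) :
    |(2 : ℝ) ^ D.card * singleCount D - fub (Nat.card α)| ≤
      2 ^ D.card * D.card ^ 2 * fub (Nat.card α - 1) := by
  induction D using Finset.induction_on with
  | empty => simp [singleCount_empty]
  | insert p D hp ih =>
    obtain ⟨h1, h2⟩ := singleCount_insert D hp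
    have h1' : (2 : ℝ) * singleCount (insert p D) ≤
      singleCount D + (D.card + 1) * fub (Nat.card α - 1) := by exact_mod_cast h1
    have h2' : (singleCount D : ℝ) ≤ 2 * singleCount (insert p D) := by exact_mod_cast h2
    rw [Finset.card_insert_of_notMem hp, abs_le] at *
    push_cast
    have h3 : (0 : ℝ) < 2 ^ D.card := by positivity
    have h4 := mul_le_mul_of_nonneg_left h1' h3.le
    have h5 := mul_le_mul_of_nonneg_left h2' h3.le
    have h6 : (0 : ℝ) ≤ 2 ^ D.card * fub (Nat.card α - 1) := by positivity
    have h7 : (0 : ℝ) ≤ D.card := by positivity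
    rw [pow_succ]
    constructor <;> nlinarith [mul_nonneg h6 h7, mul_nonneg h6 (sq_nonneg (D.card : ℝ))]

end SingleCount

end TPre

namespace TPre

section Pieces

variable {α ι : Type*}

/-- `{p}` and `{q}` are consecutive blocks (if `t`), or `p` and `q` share a block (if not). -/
def Piece (f : TPre α) (t : Bool) (p q : α) : Prop :=
  if t then f.Cov p q ∧ f.Single p ∧ f.Single q else f.Eqv p q

/-- The total preorders with prescribed pieces at the pairs `(P (inl i), P (inr i))`. -/
def pieces (P : ι ⊕ ι ↪ α) (σ : ι → Bool) : Set (TPre α) :=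
  {f | ∀ i, Piece f (σ i) (P (Sum.inl i)) (P (Sum.inr i))}

/-- The set of second points of the pairs. -/
def seconds (P : ι ⊕ ι ↪ α) : Set α := Set.range fun i => P (Sum.inr i)

theorem inl_notMem_seconds (P : ι ⊕ ι ↪ α) (i : ι) : P (Sum.inl i) ∉ seconds P := by
  rintro ⟨j, hj⟩
  simpa using P.injective hj

open Classical in
/-- Replace second points of the pairs by the corresponding first points. -/
noncomputable def retract (P : ι ⊕ ι ↪ α) (a : α) : ↥(seconds P)ᶜ :=
  if h : a ∈ seconds P then ⟨P (Sum.inl h.choose), inl_notMem_seconds P _⟩ else ⟨a, h⟩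

theorem retract_inr (P : ι ⊕ ι ↪ α) (i : ι) :
    retract P (P (Sum.inr i)) = ⟨P (Sum.inl i), inl_notMem_seconds P i⟩ := by
  have h : P (Sum.inr i) ∈ seconds P := ⟨i, rfl⟩
  have h1 : h.choose = i := Sum.inr_injective (P.injective h.choose_spec)
  rw [retract, dif_pos h, Subtype.mk.injEq, h1]

theorem retract_of_notMem (P : ι ⊕ ι ↪ α) {a : α} (h : a ∉ seconds P) :
    retract P a = ⟨a, h⟩ := by
  rw [retract, dif_neg h]

theorem retract_inl (P : ι ⊕ ι ↪ α) (i : ι) :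
    retract P (P (Sum.inl i)) = ⟨P (Sum.inl i), inl_notMem_seconds P i⟩ :=
  retract_of_notMem P _

/-- The points to be put right after the first points of their pairs. -/
def Lifted (P : ι ⊕ ι ↪ α) (σ : ι → Bool) (a : α) : Prop := ∃ i, σ i ∧ P (Sum.inr i) = a

theorem not_lifted_of_notMem {P : ι ⊕ ι ↪ α} {σ : ι → Bool} {a : α} (h : a ∉ seconds P) :
    ¬ Lifted P σ a := fun ⟨i, _, hi⟩ => h ⟨i, hi⟩

theorem lifted_inr {P : ι ⊕ ι ↪ α} {σ : ι → Bool} {i : ι} :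
    Lifted P σ (P (Sum.inr i)) ↔ σ i := by
  constructor
  · rintro ⟨j, hj, h⟩
    have : j = i := by simpa using P.injective h
    exact this ▸ hj
  · exact fun h => ⟨i, h, rfl⟩

/-- Insert the second points of the pairs. -/
noncomputable def expand (P : ι ⊕ ι ↪ α) (σ : ι → Bool) (h : TPre ↥(seconds P)ᶜ) : TPre α :=
  (h.comap (retract P)).lex (Lifted P σ)

theorem expand_comap_val (P : ι ⊕ ι ↪ α) (σ : ι → Bool) (h : TPre ↥(seconds P)ᶜ) :
    (expand P σ h).comap Subtype.val = h := by
  ext a b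
  rw [comap_le, expand, lex_le, comap_le, comap_le, retract_of_notMem P a.2,
    retract_of_notMem P b.2]
  simp [not_lifted_of_notMem a.2]

theorem expand_mem_pieces {P : ι ⊕ ι ↪ α} {σ : ι → Bool} {h : TPre ↥(seconds P)ᶜ}
    (hh : ∀ i, σ i → h.Single ⟨P (Sum.inl i), inl_notMem_seconds P i⟩) :
    expand P σ h ∈ pieces P σ := by
  intro i
  have hp : ¬ Lifted P σ (P (Sum.inl i)) := not_lifted_of_notMem (inl_notMem_seconds P i)
  unfold Piece
  split_ifs with hi
  · have hq : Lifted P σ (P (Sum.inr i)) := lifted_inr.2 hi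
    have key : ∀ b, h.Eqv ⟨P (Sum.inl i), inl_notMem_seconds P i⟩ (retract P b) →
        b = P (Sum.inl i) ∨ b = P (Sum.inr i) := by
      intro b hb
      have h1 := hh i hi _ hb
      by_cases h2 : b ∈ seconds P
      · obtain ⟨j, rfl⟩ := h2
        rw [retract_inr] at h1
        have : j = i := by simpa using P.injective (congrArg Subtype.val h1)
        exact Or.inr (by rw [this])
      · rw [retract_of_notMem P h2] at h1
        exact Or.inl (congrArg Subtype.val h1)
    refine ⟨⟨?_, fun c => ?_⟩, fun b hb => ?_, fun b hb => ?_⟩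
    · rw [expand, lex_le, comap_le, comap_le, retract_inr, retract_inl]
      exact fun h1 => hp (h1.2 (h.refl _) hq)
    · rw [expand, lex_le, lex_le, comap_le, comap_le, comap_le, comap_le, retract_inr, retract_inl]
      have := h.total (retract P c) ⟨P (Sum.inl i), inl_notMem_seconds P i⟩
      tauto
    · rw [expand, lex_eqv, comap_eqv, retract_inl] at hb
      exact (key b hb.1).resolve_right fun h1 => hp (hb.2.2 (h1 ▸ hq))
    · rw [expand, lex_eqv, comap_eqv, retract_inr] at hb
      exact (key b hb.1).resolve_left fun h1 => hp (h1 ▸ hb.2.1 hq)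
  · rw [expand, lex_eqv, comap_eqv, retract_inr, retract_inl, lifted_inr]
    exact ⟨Eqv.refl _ _, by tauto⟩

theorem expand_of_mem_pieces {P : ι ⊕ ι ↪ α} {σ : ι → Bool} {f : TPre α} (hf : f ∈ pieces P σ) :
    expand P σ (f.comap Subtype.val) = f := by
  have key : ∀ a, (¬ Lifted P σ a ∧ f.Eqv (retract P a) a) ∨
      (Lifted P σ a ∧ f.Cov (retract P a) a ∧ f.Single a) := by
    intro a
    by_cases h : a ∈ seconds P
    · obtain ⟨i, rfl⟩ := h
      have := hf i
      simp only [retract_inr, lifted_inr]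
      unfold Piece at this
      split_ifs at this with hi
      · exact Or.inr ⟨hi, this.1, this.2.2⟩
      · exact Or.inl ⟨hi, this⟩
    · rw [retract_of_notMem P h]
      exact Or.inl ⟨not_lifted_of_notMem h, Eqv.refl _ _⟩
  have key1 : ∀ {c d}, f.Cov c d → ∀ a, f.le d a ↔ ¬ f.le a c :=
    fun hk a => ⟨fun h h' => hk.1 (f.trans _ _ _ h h'), fun h => (hk.2 a).resolve_left h⟩
  have key2 : ∀ {a b c d}, f.Eqv a b → f.Eqv c d → (f.le b d ↔ f.le a c) := fun h h' =>
    ⟨fun h1 => f.trans _ _ _ (f.trans _ _ _ h.1 h1) h'.2,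
      fun h1 => f.trans _ _ _ (f.trans _ _ _ h.2 h1) h'.1⟩
  ext a b
  rw [expand, lex_le, comap_le, comap_le, comap_le, comap_le]
  rcases key a with ⟨ha, ha'⟩ | ⟨ha, ha', ha''⟩ <;> rcases key b with ⟨hb, hb'⟩ | ⟨hb, hb', hb''⟩
  · simp only [ha, hb, false_imp_iff, imp_true_iff, and_true]
    exact (key2 ha' hb').symm
  · simp only [ha, hb, imp_true_iff, and_true]
    rw [key2 ha' (Eqv.refl f b)]
    constructor
    · exact fun h => f.trans _ _ _ h (f.le_of_not_le hb'.1)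
    · intro h
      refine (hb'.2 _).resolve_right fun h1 => ?_
      have h2 := hb'' _ ⟨h1, h⟩
      obtain ⟨i, -, hi⟩ := hb
      exact (retract P a).2 (h2 ▸ ⟨i, hi⟩)
  · simp only [ha, hb, imp_false]
    rw [key1 ha', key2 hb' (Eqv.refl f _)]
    have := f.total (retract P a) (retract P b)
    tauto
  · simp only [hb, imp_true_iff, and_true]
    rw [key1 ha', key1 hb', not_not]

open Classical in
theorem ncard_pieces [Fintype ι] (P : ι ⊕ ι ↪ α) (σ : ι → Bool) :
    ∃ D : Finset ↥(seconds P)ᶜ, D.card = (Finset.univ.filter fun i => σ i = true).card ∧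
      (pieces P σ).ncard = singleCount D := by
  let p : ι ↪ ↥(seconds P)ᶜ := ⟨fun i => ⟨P (Sum.inl i), inl_notMem_seconds P i⟩, fun i j h => by
    simpa using P.injective (congrArg Subtype.val h)⟩
  refine ⟨(Finset.univ.filter fun i => σ i = true).map p, by simp, ?_⟩
  rw [singleCount]
  refine Set.ncard_congr (fun f _ => f.comap Subtype.val) ?_ ?_ ?_
  · intro f hf d hd b hb
    obtain ⟨i, hi, rfl⟩ := Finset.mem_map.1 hd
    have := hf i
    rw [Piece, if_pos (Finset.mem_filter.1 hi).2] at this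
    exact Subtype.ext (this.2.1 b hb)
  · intro f g hf hg h
    rw [← expand_of_mem_pieces hf, ← expand_of_mem_pieces hg, h]
  · intro h hh
    refine ⟨expand P σ h, expand_mem_pieces fun i hi => ?_, expand_comap_val P σ h⟩
    exact hh (p i) (Finset.mem_map_of_mem _ (Finset.mem_filter.2 ⟨Finset.mem_univ _, hi⟩))

theorem ncard_compl_seconds [Finite α] [Fintype ι] (P : ι ⊕ ι ↪ α) :
    Nat.card ↥(seconds P)ᶜ = Nat.card α - Fintype.card ι := by
  have h : Function.Injective fun i => P (Sum.inr i) := fun i j h => by simpa using P.injective h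
  have h1 : (seconds P).ncard = Fintype.card ι := by
    rw [← Nat.card_coe_set_eq, seconds, Nat.card_range_of_injective h, Nat.card_eq_fintype_card]
  rw [Nat.card_coe_set_eq, Set.ncard_compl, h1]

theorem abs_ncard_pieces_sub_le [Finite α] [Fintype ι] (P : ι ⊕ ι ↪ α) (σ : ι → Bool) :
    |(2 : ℝ) ^ (Finset.univ.filter fun i => σ i = true).card * (pieces P σ).ncard -
        fub (Nat.card α - Fintype.card ι)| ≤
      2 ^ Fintype.card ι * Fintype.card ι ^ 2 * fub (Nat.card α - Fintype.card ι - 1) := by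
  classical
  obtain ⟨D, hD, h⟩ := ncard_pieces P σ
  have h1 := abs_two_pow_mul_singleCount_sub_le D
  rw [hD, ← h, ncard_compl_seconds] at h1
  refine h1.trans ?_
  have h2 : (Finset.univ.filter fun i => σ i = true).card ≤ Fintype.card ι := Finset.card_le_univ _
  gcongr
  norm_num

end Pieces

end TPre

namespace TPre

section Nice

variable {α ι : Type*}

/-- A pair of points which are consecutive singleton blocks on one side and equivalent on the
other. -/
def Nice (x : TPre α × TPre α) (t : Bool) (p q : α) : Prop :=
  Piece x.1 t p q ∧ Piece x.2 (!t) p q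

/-- A nice pair which cannot be continued to the right. -/
def Top (x : TPre α × TPre α) (t : Bool) (p q : α) : Prop :=
  Nice x t p q ∧ ¬ ∃ z, Nice x t q z

theorem Nice.cov {x : TPre α × TPre α} {t : Bool} {p q : α} (h : Nice x t p q) :
    ∃ f g : TPre α, (f = x.1 ∧ g = x.2 ∧ t = true ∨ f = x.2 ∧ g = x.1 ∧ t = false) ∧
      f.Cov p q ∧ f.Single p ∧ f.Single q ∧ g.Eqv p q := by
  cases t
  · exact ⟨x.2, x.1, by simp, h.2.1, h.2.2.1, h.2.2.2, h.1⟩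
  · exact ⟨x.1, x.2, by simp, h.1.1, h.1.2.1, h.1.2.2, h.2⟩

theorem Nice.ne {x : TPre α × TPre α} {t : Bool} {p q : α} (h : Nice x t p q) : p ≠ q := by
  obtain ⟨f, g, -, h1, -⟩ := h.cov
  rintro rfl
  exact h1.1 (f.refl _)

theorem Cov.left_unique {f : TPre α} {p p' q : α} (h : f.Cov p q) (h' : f.Cov p' q)
    (hp : f.Single p) : p' = p := by
  refine hp p' ⟨(h'.2 p).resolve_right fun h1 => h.1 h1, (h.2 p').resolve_right fun h1 => h'.1 h1⟩

theorem Cov.right_unique {f : TPre α} {p q q' : α} (h : f.Cov p q) (h' : f.Cov p q')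
    (hq : f.Single q) : q' = q := by
  refine hq q' ⟨(h.2 q').resolve_left fun h1 => h'.1 h1, (h'.2 q).resolve_left fun h1 => h.1 h1⟩

/-- Nice pairs of different types are disjoint. -/
theorem Nice.type_eq {x : TPre α × TPre α} {t t' : Bool} {p q p' q' : α} (h : Nice x t p q)
    (h' : Nice x t' p' q') (hpq : p = p' ∨ p = q' ∨ q = p' ∨ q = q') : t = t' := by
  have hne := h.ne
  have hne' := h'.ne
  obtain ⟨h1, h2⟩ := h
  obtain ⟨h3, h4⟩ := h'
  unfold Piece at h1 h2 h3 h4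
  cases t <;> cases t' <;> simp only [Bool.not_true, Bool.not_false, if_true, if_false,
    Bool.false_eq_true, Bool.true_eq_false] at * <;>
  · obtain rfl | rfl | rfl | rfl := hpq
    · first | exact hne (h3.2.1 _ h1).symm | exact hne' (h1.2.1 _ h3).symm
    · first | exact hne (h3.2.2 _ h1).symm | exact hne' (h1.2.1 _ h3.symm)
    · first | exact hne (h3.2.1 _ h1.symm) | exact hne' (h1.2.2 _ h3).symm
    · first | exact hne (h3.2.2 _ h1.symm) | exact hne' (h1.2.2 _ h3.symm)

theorem Nice.left_unique {x : TPre α × TPre α} {t : Bool} {p p' q : α} (h : Nice x t p q)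
    (h' : Nice x t p' q) : p = p' := by
  obtain ⟨h1, h2⟩ := h
  obtain ⟨h3, h4⟩ := h'
  cases t
  · exact h4.1.left_unique h2.1 h4.2.1
  · exact h3.1.left_unique h1.1 h3.2.1

theorem Nice.right_unique {x : TPre α × TPre α} {t : Bool} {p q q' : α} (h : Nice x t p q)
    (h' : Nice x t p q') : q = q' := by
  obtain ⟨h1, h2⟩ := h
  obtain ⟨h3, h4⟩ := h'
  cases t
  · exact h4.1.right_unique h2.1 h4.2.2
  · exact h3.1.right_unique h1.1 h3.2.2

theorem ncard_piece_le [Finite α] {p z : α} (h : p ≠ z) (t : Bool) :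
    {f : TPre α | Piece f t p z}.ncard ≤ fub (Nat.card α - 1) := by
  have h0 : ({z}ᶜ : Set α).ncard = Nat.card α - 1 := by
    rw [Set.ncard_compl, Set.ncard_singleton]
  rw [← h0]
  refine card_le_fub _ _ fun f hf g hg hfg => AgreeOn.eq ?_
  rw [← insert_compl_singleton z]
  cases t
  · exact hfg.extend_of_eqv (c := p) h hf hg
  · exact hfg.extend_of_cov_single (c := p) h (by simp) hf.1 hg.1 hf.2.2 hg.2.2

theorem ncard_pieces_piece_le [Finite α] [Fintype ι] (P : ι ⊕ ι ↪ α) (σ : ι → Bool) (i : ι) {z : α}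
    (hz : z ∉ seconds P) (hne : P (Sum.inl i) ≠ z) :
    {f | f ∈ pieces P σ ∧ Piece f (σ i) (P (Sum.inr i)) z}.ncard ≤
      fub (Nat.card α - Fintype.card ι - 1) := by
  rw [← ncard_compl_seconds P]
  have hne' : (⟨P (Sum.inl i), inl_notMem_seconds P i⟩ : ↥(seconds P)ᶜ) ≠ ⟨z, hz⟩ :=
    fun h => hne (congrArg Subtype.val h)
  refine le_trans ?_ (ncard_piece_le hne' (σ i))
  refine Set.ncard_le_ncard_of_injOn (fun f => f.comap Subtype.val) ?_ ?_
  · rintro f ⟨hf, h1⟩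
    have h2 := hf i
    simp only [Set.mem_ofPred_eq]
    unfold Piece at *
    split_ifs at * with hi
    · refine ⟨⟨fun h => h1.1.1 (f.trans _ _ _ h (f.le_of_not_le h2.1.1)), fun c => ?_⟩, ?_, ?_⟩
      · refine (h1.1.2 c).imp_left fun h => (h2.1.2 c).resolve_right fun h3 => c.2 ?_
        exact ⟨i, (h2.2.2 c ⟨h3, h⟩).symm⟩
      · exact fun b hb => Subtype.ext (h2.2.1 b hb)
      · exact fun b hb => Subtype.ext (h1.2.2 b hb)
    · exact h2.trans h1
  · intro f hf g hg h
    rw [← expand_of_mem_pieces hf.1, ← expand_of_mem_pieces hg.1]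
    exact congrArg (expand P σ) h

/-- The pairs of total preorders in which all the pairs of points given by `P` are nice. -/
def niceAll (P : ι ⊕ ι ↪ α) (σ : ι → Bool) : Set (TPre α × TPre α) :=
  {x | ∀ i, Nice x (σ i) (P (Sum.inl i)) (P (Sum.inr i))}

/-- The pairs of total preorders in which all the pairs of points given by `P` are top pairs. -/
def topAll (P : ι ⊕ ι ↪ α) (σ : ι → Bool) : Set (TPre α × TPre α) :=
  {x | ∀ i, Top x (σ i) (P (Sum.inl i)) (P (Sum.inr i))}

theorem niceAll_eq (P : ι ⊕ ι ↪ α) (σ : ι → Bool) :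
    niceAll P σ = pieces P σ ×ˢ pieces P fun i => !σ i := by
  ext x
  exact forall_and

theorem ncard_niceAll_nice_le [Finite α] [Fintype ι] (P : ι ⊕ ι ↪ α) (σ : ι → Bool) (i : ι) (z : α) :
    {x | x ∈ niceAll P σ ∧ Nice x (σ i) (P (Sum.inr i)) z}.ncard ≤
      fub (Nat.card α - Fintype.card ι - 1) ^ 2 := by
  by_cases hz : z ∉ seconds P ∧ P (Sum.inl i) ≠ z
  · rw [sq]
    refine le_trans ?_ (Nat.mul_le_mul (ncard_pieces_piece_le P σ i hz.1 hz.2)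
      (ncard_pieces_piece_le P (fun i => !σ i) i hz.1 hz.2))
    rw [← Set.ncard_prod]
    refine Set.ncard_le_ncard ?_
    rintro x ⟨h1, h2⟩
    rw [niceAll_eq] at h1
    exact ⟨⟨h1.1, h2.1⟩, ⟨h1.2, h2.2⟩⟩
  · convert Nat.zero_le _
    rw [Set.ncard_eq_zero, Set.eq_empty_iff_forall_notMem]
    rintro x ⟨h1, h2⟩
    refine hz ⟨?_, ?_⟩
    · rintro ⟨j, rfl⟩
      have h3 := (h1 j).type_eq h2 (by simp)
      have h4 := h1 j
      rw [h3] at h4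
      simpa using P.injective (h4.left_unique h2)
    · rintro rfl
      have h3 := h1 i
      obtain ⟨f, g, h4, h5, -⟩ := h3.cov
      obtain ⟨f', g', h4', h5', -⟩ := h2.cov
      have : f = f' := by
        rcases h4 with ⟨rfl, -, h⟩ | ⟨rfl, -, h⟩ <;> rcases h4' with ⟨rfl, -, h'⟩ | ⟨rfl, -, h'⟩ <;>
          simp_all
      subst this
      exact h5.1 (f.le_of_not_le h5'.1)

theorem ncard_topAll_le [Finite α] (P : ι ⊕ ι ↪ α) (σ : ι → Bool) :
    (topAll P σ).ncard ≤ (niceAll P σ).ncard :=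
  Set.ncard_le_ncard fun _ hx i => (hx i).1

theorem ncard_niceAll_le [Finite α] [Fintype ι] (P : ι ⊕ ι ↪ α) (σ : ι → Bool) :
    (niceAll P σ).ncard ≤ (topAll P σ).ncard + Fintype.card ι * Nat.card α *
      fub (Nat.card α - Fintype.card ι - 1) ^ 2 := by
  have := Fintype.ofFinite α
  have h1 : niceAll P σ ⊆ topAll P σ ∪ ⋃ y ∈ (Finset.univ : Finset (ι × α)),
      {x | x ∈ niceAll P σ ∧ Nice x (σ y.1) (P (Sum.inr y.1)) y.2} := by
    intro x hx
    by_contra! h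
    simp only [Set.mem_union, Set.mem_iUnion, Finset.mem_univ, not_or, not_exists,
      Set.mem_ofPred_eq, Prod.forall, true_imp_iff] at h
    exact h.1 fun i => ⟨hx i, fun ⟨z, hz⟩ => h.2 i z ⟨hx, hz⟩⟩
  refine (Set.ncard_le_ncard h1).trans ((Set.ncard_union_le _ _).trans ?_)
  gcongr
  refine (Finset.set_ncard_biUnion_le _ _).trans ?_
  refine (Finset.sum_le_sum fun y _ => ncard_niceAll_nice_le P σ y.1 y.2).trans ?_
  rw [Finset.sum_const, smul_eq_mul, Finset.card_univ, Fintype.card_prod, Nat.card_eq_fintype_card]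

end Nice

end TPre

namespace TPre

section Bad

variable {α : Type*}

theorem AgreeOn.extend_of_link {S : Set α} {f g : TPre α} (h : AgreeOn S f g) {c d : α}
    (hc : c ∈ S) (hf : f.Eqv c d ∨ f.Cov c d) (hg : g.Eqv c d ∨ g.Cov c d)
    (h1 : f.Eqv c d ↔ g.Eqv c d) (h2 : (∃ b ∈ S, f.Eqv b d) ↔ ∃ b ∈ S, g.Eqv b d) :
    AgreeOn (insert d S) f g := by
  by_cases h3 : f.Eqv c d
  · exact h.extend_of_eqv hc h3 (h1.1 h3)
  · exact h.extend_of_cov hc (hf.resolve_left h3) (hg.resolve_left (h1.not.1 h3)) h2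

theorem ncard_cov_link_le [Finite α] {p q z : α} (hpq : p ≠ q) (hzp : z ≠ p) (hzq : z ≠ q) :
    {f : TPre α | f.Cov p q ∧ (f.Eqv z p ∨ f.Eqv z q ∨ f.Cov q z)}.ncard ≤
      fub (Nat.card α - 2) * 32 := by
  have h0 : ({q, z}ᶜ : Set α).ncard = Nat.card α - 2 := by
    rw [Set.ncard_compl, Set.ncard_pair hzq.symm]
  have hu : insert z (insert q ({q, z}ᶜ : Set α)) = Set.univ := by
    ext a
    simp only [Set.mem_insert_iff, Set.mem_compl_iff, Set.mem_singleton_iff, Set.mem_univ, iff_true]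
    tauto
  have hp : p ∈ ({q, z}ᶜ : Set α) := by simp [hpq, hzp.symm]
  have hκ : Nat.card (Prop × Prop × Prop × Prop) = 16 := by
    simp [Nat.card_eq_fintype_card]
  rw [← h0]
  refine (card_le_fub_mul (κ := Prop × Prop × Prop × Prop) _ ({q, z}ᶜ : Set α)
    (fun f => (f.Eqv p z, f.Eqv q z, ∃ b ∈ ({q, z}ᶜ : Set α), f.Eqv b q,
      ∃ b ∈ insert q ({q, z}ᶜ : Set α), f.Eqv b z)) ?_).trans (Nat.mul_le_mul_left _ (by omega))
  intro f hf g hg hfg h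
  simp only [Prod.mk.injEq] at h
  obtain ⟨h1, h2, h3, h4⟩ := h
  have hne : ∀ k : TPre α, k.Cov p q → ¬ k.Eqv p q := fun k hk h => hk.1 h.2
  have h5 := hfg.extend_of_cov hp hf.1 hg.1 (iff_of_eq h3)
  apply AgreeOn.eq
  rw [← hu]
  by_cases h6 : f.Eqv p z
  · exact h5.extend_of_eqv (Set.mem_insert_of_mem _ hp) h6 (h1 ▸ h6)
  · have h7 : ¬ g.Eqv p z := h1 ▸ h6
    refine h5.extend_of_link (Set.mem_insert _ _) ?_ ?_ (iff_of_eq h2) (iff_of_eq h4)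
    · exact (hf.2.resolve_left fun h => h6 h.symm).imp_left Eqv.symm
    · exact (hg.2.resolve_left fun h => h7 h.symm).imp_left Eqv.symm

theorem ncard_eqv_eqv_le [Finite α] {p q z : α} (hpq : p ≠ q) (hzp : z ≠ p) (hzq : z ≠ q) :
    {f : TPre α | f.Eqv q p ∧ f.Eqv z p}.ncard ≤ fub (Nat.card α - 2) := by
  have h0 : ({q, z}ᶜ : Set α).ncard = Nat.card α - 2 := by
    rw [Set.ncard_compl, Set.ncard_pair hzq.symm]
  have hu : insert z (insert q ({q, z}ᶜ : Set α)) = Set.univ := by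
    ext a
    simp only [Set.mem_insert_iff, Set.mem_compl_iff, Set.mem_singleton_iff, Set.mem_univ, iff_true]
    tauto
  have hp : p ∈ ({q, z}ᶜ : Set α) := by simp [hpq, hzp.symm]
  rw [← h0]
  refine card_le_fub _ _ fun f hf g hg hfg => AgreeOn.eq ?_
  rw [← hu]
  exact (hfg.extend_of_eqv hp hf.1.symm hg.1.symm).extend_of_eqv (Set.mem_insert_of_mem _ hp)
    hf.2.symm hg.2.symm

/-- Three points forcing an exceptional merge of blocks of `f`. -/
def Bad (f g : TPre α) (p q z : α) : Prop :=
  (f.Cov p q ∧ (f.Eqv z p ∨ f.Eqv z q ∨ f.Cov q z)) ∧ (g.Eqv q p ∧ g.Eqv z p) ∧ z ≠ p ∧ z ≠ q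

theorem ncard_bad_le [Finite α] (p q z : α) :
    {x : TPre α × TPre α | Bad x.1 x.2 p q z}.ncard ≤ fub (Nat.card α - 2) ^ 2 * 32 := by
  by_cases h : p ≠ q ∧ z ≠ p ∧ z ≠ q
  · calc _ ≤ ({f : TPre α | f.Cov p q ∧ (f.Eqv z p ∨ f.Eqv z q ∨ f.Cov q z)} ×ˢ
          {f : TPre α | f.Eqv q p ∧ f.Eqv z p}).ncard :=
          Set.ncard_le_ncard fun x hx => ⟨hx.1, hx.2.1⟩
      _ ≤ (fub (Nat.card α - 2) * 32) * fub (Nat.card α - 2) := by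
          rw [Set.ncard_prod]
          exact Nat.mul_le_mul (ncard_cov_link_le h.1 h.2.1 h.2.2)
            (ncard_eqv_eqv_le h.1 h.2.1 h.2.2)
      _ = _ := by ring
  · convert Nat.zero_le _
    rw [Set.ncard_eq_zero, Set.eq_empty_iff_forall_notMem]
    rintro x ⟨⟨h1, -⟩, -, h2⟩
    refine h ⟨?_, h2⟩
    rintro rfl
    exact h1.1 (x.1.refl _)

theorem ncard_bad_swap_le [Finite α] (p q z : α) :
    {x : TPre α × TPre α | Bad x.2 x.1 p q z}.ncard ≤ fub (Nat.card α - 2) ^ 2 * 32 := by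
  refine le_trans ?_ (ncard_bad_le p q z)
  exact Set.ncard_le_ncard_of_injOn Prod.swap (fun x hx => hx) Prod.swap_injective.injOn

/-- The pairs of total preorders without top pairs. -/
def noTop (α : Type*) : Set (TPre α × TPre α) := {x | ∀ t p q, ¬ Top x t p q}

theorem Nice.not_reduced {x : TPre α × TPre α} {t : Bool} {p q : α} (h : Nice x t p q) :
    ¬ Reduced x.1 x.2 := by
  have key : ∀ f g : TPre α, f.Cov p q → f.Single p → f.Single q → g.Eqv p q → ¬ NoMerge f g := by
    intro f g h1 h2 h3 h4 h5
    refine h5 ⟨p, q, h1, ?_⟩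
    rintro z (h6 | h6)
    · rw [h2 z h6.symm]
      exact Eqv.refl _ _
    · rw [h3 z h6.symm]
      exact h4.symm
  obtain ⟨f, g, h1, h2, h3, h4, h5⟩ := h.cov
  rintro ⟨h6, h7⟩
  rcases h1 with ⟨rfl, rfl, -⟩ | ⟨rfl, rfl, -⟩
  · exact key _ _ h2 h3 h4 h5 h6
  · exact key _ _ h2 h3 h4 h5 h7

theorem exists_bad {f g : TPre α} (h : ¬ NoMerge f g)
    (h' : ∀ p q, f.Cov p q → f.Single p → f.Single q → g.Eqv p q →
      ∃ z, f.Cov q z ∧ g.Eqv q z) : ∃ p q z, Bad f g p q z := by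
  rw [NoMerge, not_not] at h
  obtain ⟨p, q, h1, h2⟩ := h
  have hqp : g.Eqv q p := h2 q (Or.inr (Eqv.refl _ _))
  by_cases hp : f.Single p
  · by_cases hq : f.Single q
    · obtain ⟨z, h3, h4⟩ := h' p q h1 hp hq hqp.symm
      refine ⟨p, q, z, ⟨h1, Or.inr (Or.inr h3)⟩, ⟨hqp, h4.symm.trans hqp⟩, ?_, ?_⟩
      · rintro rfl
        exact h1.1 (f.le_of_not_le h3.1)
      · rintro rfl
        exact h3.1 (f.refl _)
    · simp only [Single, not_forall] at hq
      obtain ⟨z, h3, h4⟩ := hq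
      refine ⟨p, q, z, ⟨h1, Or.inr (Or.inl h3.symm)⟩, ⟨hqp, h2 z (Or.inr h3.symm)⟩, ?_, h4⟩
      rintro rfl
      exact h1.1 h3.1
  · simp only [Single, not_forall] at hp
    obtain ⟨z, h3, h4⟩ := hp
    refine ⟨p, q, z, ⟨h1, Or.inl h3.symm⟩, ⟨hqp, h2 z (Or.inl h3.symm)⟩, h4, ?_⟩
    rintro rfl
    exact h1.1 h3.2

theorem ncard_reduced_le [Finite α] :
    {x : TPre α × TPre α | Reduced x.1 x.2}.ncard ≤ (noTop α).ncard :=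
  Set.ncard_le_ncard fun _ hx _ _ _ h => h.1.not_reduced hx

theorem ncard_noTop_le [Finite α] :
    (noTop α).ncard ≤ {x : TPre α × TPre α | Reduced x.1 x.2}.ncard +
      64 * Nat.card α ^ 3 * fub (Nat.card α - 2) ^ 2 := by
  have := Fintype.ofFinite α
  have h1 : noTop α ⊆ {x : TPre α × TPre α | Reduced x.1 x.2} ∪
      ⋃ y ∈ (Finset.univ : Finset (α × α × α)), ({x | Bad x.1 x.2 y.1 y.2.1 y.2.2} ∪
        {x | Bad x.2 x.1 y.1 y.2.1 y.2.2}) := by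
    intro x hx
    by_cases hr : Reduced x.1 x.2
    · exact Or.inl hr
    right
    have hN : ∀ t p q, Nice x t p q → ∃ z, Nice x t q z := fun t p q h => by
      by_contra h'
      exact hx t p q ⟨h, h'⟩
    simp only [Set.mem_iUnion, Finset.mem_univ, exists_const, Set.mem_union, Set.mem_ofPred_eq,
      Prod.exists]
    rw [Reduced, not_and_or] at hr
    rcases hr with hr | hr
    · obtain ⟨p, q, z, h⟩ := exists_bad hr fun p q h1 h2 h3 h4 => by
        obtain ⟨z, hz⟩ := hN true p q ⟨⟨h1, h2, h3⟩, h4⟩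
        exact ⟨z, hz.1.1, hz.2⟩
      exact ⟨p, q, z, Or.inl h⟩
    · obtain ⟨p, q, z, h⟩ := exists_bad hr fun p q h1 h2 h3 h4 => by
        obtain ⟨z, hz⟩ := hN false p q ⟨h4, ⟨h1, h2, h3⟩⟩
        exact ⟨z, hz.2.1, hz.1⟩
      exact ⟨p, q, z, Or.inr h⟩
  refine (Set.ncard_le_ncard h1).trans ((Set.ncard_union_le _ _).trans ?_)
  gcongr
  refine (Finset.set_ncard_biUnion_le _ _).trans ?_
  refine (Finset.sum_le_sum fun y _ => (Set.ncard_union_le _ _).trans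
    (Nat.add_le_add (ncard_bad_le y.1 y.2.1 y.2.2) (ncard_bad_swap_le y.1 y.2.1 y.2.2))).trans ?_
  rw [Finset.sum_const, smul_eq_mul, Finset.card_univ, Fintype.card_prod, Fintype.card_prod,
    Nat.card_eq_fintype_card]
  apply le_of_eq
  ring

end Bad

end TPre

open Filter Topology in
/-- The method of factorial moments for convergence to a Poisson law, at the value `0`. -/
theorem tendsto_card_eq_zero_of_factorial_moments {Ω : ℕ → Type*} [∀ n, Fintype (Ω n)]
    (Y : ∀ n, Ω n → ℕ) (c : ℕ → ℝ) (hc : ∀ n, 0 ≤ c n) (l : ℝ)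
    (h : ∀ r, Tendsto (fun n => (∑ x, ((Y n x).descFactorial r : ℝ)) / c n) atTop (𝓝 (l ^ r))) :
    Tendsto (fun n => ({x | Y n x = 0}.ncard : ℝ) / c n) atTop (𝓝 (Real.exp (-l))) := by
  have hb : ∀ m y : ℕ, (∑ k ∈ Finset.range (2 * m + 2), (-1 : ℝ) ^ k * y.choose k) ≤
      (if y = 0 then 1 else 0) ∧ (if y = 0 then (1 : ℝ) else 0) ≤
        ∑ k ∈ Finset.range (2 * m + 1), (-1 : ℝ) ^ k * y.choose k := by
    intro m y
    rcases y with - | y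
    · have : ∀ N : ℕ, ∑ k ∈ Finset.range (N + 1), (-1 : ℝ) ^ k * (Nat.choose 0 k : ℝ) = 1 := by
        intro N
        rw [Finset.sum_range_succ']
        simp
      rw [this, this]
      simp
    · have : ∀ N : ℕ, ∑ k ∈ Finset.range (N + 1), (-1 : ℝ) ^ k * ((y + 1).choose k : ℝ) =
          (-1) ^ N * y.choose N := by
        intro N
        exact_mod_cast Int.alternating_sum_range_choose_eq_choose (n := y) (m := N)
      rw [this, this, pow_succ, pow_mul]
      simp
  have hz : ∀ n, ({x | Y n x = 0}.ncard : ℝ) = ∑ x, if Y n x = 0 then (1 : ℝ) else 0 := by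
    intro n
    rw [Finset.sum_boole, Set.ncard_eq_toFinset_card']
    simp
  have hs : ∀ n N, (∑ x, ∑ k ∈ Finset.range N, (-1 : ℝ) ^ k * (Y n x).choose k) / c n =
      ∑ k ∈ Finset.range N, (-1 : ℝ) ^ k / k.factorial *
        ((∑ x, ((Y n x).descFactorial k : ℝ)) / c n) := by
    intro n N
    rw [Finset.sum_comm, Finset.sum_div]
    refine Finset.sum_congr rfl fun k _ => ?_
    rw [← Finset.mul_sum, mul_div_assoc, div_mul_eq_mul_div, mul_div_assoc]
    congr 1
    rw [div_right_comm, Finset.sum_div _ _ (k.factorial : ℝ)]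
    congr 1
    refine Finset.sum_congr rfl fun x _ => ?_
    rw [Nat.choose_eq_descFactorial_div_factorial, Nat.cast_div (Nat.factorial_dvd_descFactorial _ _)
      (by positivity)]
  have hlim : ∀ N, Tendsto (fun n => (∑ x, ∑ k ∈ Finset.range N,
      (-1 : ℝ) ^ k * (Y n x).choose k) / c n) atTop
      (𝓝 (∑ k ∈ Finset.range N, (-l) ^ k / k.factorial)) := by
    intro N
    simp only [hs]
    refine tendsto_finsetSum _ fun k _ => ?_
    have := (h k).const_mul ((-1 : ℝ) ^ k / k.factorial)
    convert this using 2
    rw [neg_pow]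
    ring
  have hexp : Tendsto (fun N => ∑ k ∈ Finset.range N, (-l) ^ k / k.factorial) atTop
      (𝓝 (Real.exp (-l))) := by
    rw [Real.exp_eq_exp_ℝ]
    exact (NormedSpace.expSeries_div_hasSum_exp (-l)).tendsto_sum_nat
  have he : Tendsto (fun m : ℕ => 2 * m) atTop atTop :=
    tendsto_id.const_mul_atTop' (by norm_num)
  rw [tendsto_order]
  constructor
  · intro a ha
    obtain ⟨m, hm⟩ := (((hexp.comp (tendsto_add_atTop_nat 2)).comp he).eventually_const_lt ha).exists
    filter_upwards [(hlim _).eventually_const_lt hm] with n hn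
    refine hn.trans_le ?_
    rw [hz]
    exact div_le_div_of_nonneg_right (Finset.sum_le_sum fun x _ => (hb m _).1) (hc n)
  · intro a ha
    obtain ⟨m, hm⟩ := (((hexp.comp (tendsto_add_atTop_nat 1)).comp he).eventually_lt_const ha).exists
    filter_upwards [(hlim _).eventually_lt_const hm] with n hn
    refine lt_of_le_of_lt ?_ hn
    rw [hz]
    exact div_le_div_of_nonneg_right (Finset.sum_le_sum fun x _ => (hb m _).2) (hc n)

namespace TPre

section Moments

variable {α : Type*}

/-- The number of top pairs. -/
noncomputable def topCount (x : TPre α × TPre α) : ℕ :=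
  Nat.card {y : Bool × α × α // Top x y.1 y.2.1 y.2.2}

/-- Tuples of top pairs correspond to tuples of pairs with disjoint supports. -/
def topTuplesEquiv (x : TPre α × TPre α) (r : ℕ) :
    (Fin r ↪ {y : Bool × α × α // Top x y.1 y.2.1 y.2.2}) ≃
      {y : (Fin r ⊕ Fin r ↪ α) × (Fin r → Bool) // x ∈ topAll y.1 y.2} where
  toFun e := ⟨⟨⟨Sum.elim (fun i => (e i).1.2.1) (fun i => (e i).1.2.2), by
    have hcross : ∀ i j, (e i).1.2.1 ≠ (e j).1.2.2 := by
      intro i j h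
      have h1 := (e i).2.1
      rw [h, h1.type_eq (e j).2.1 (by simp)] at h1
      exact (e j).2.2 ⟨_, h1⟩
    rintro (i | i) (j | j) h
    · have h : (e i).1.2.1 = (e j).1.2.1 := h
      have h1 := (e i).2.1
      have h2 := h1.type_eq (e j).2.1 (by simp [h])
      rw [h2, h] at h1
      have h3 := h1.right_unique (e j).2.1
      rw [e.injective (Subtype.ext (Prod.ext h2 (Prod.ext h h3)))]
    · exact absurd h (hcross i j)
    · exact absurd h.symm (hcross j i)
    · have h : (e i).1.2.2 = (e j).1.2.2 := h
      have h1 := (e i).2.1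
      have h2 := h1.type_eq (e j).2.1 (by simp [h])
      rw [h2, h] at h1
      have h3 := h1.left_unique (e j).2.1
      rw [e.injective (Subtype.ext (Prod.ext h2 (Prod.ext h3 h)))]⟩,
    fun i => (e i).1.1⟩, fun i => (e i).2⟩
  invFun y := ⟨fun i => ⟨(y.1.2 i, y.1.1 (Sum.inl i), y.1.1 (Sum.inr i)), y.2 i⟩, fun i j h => by
    simpa using y.1.1.injective (congrArg (fun w => w.1.2.1) h)⟩
  left_inv e := rfl
  right_inv y := by
    refine Subtype.ext (Prod.ext (Function.Embedding.ext ?_) rfl)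
    rintro (i | i) <;> rfl

theorem sum_descFactorial_topCount [Fintype α] [Fintype (TPre α × TPre α)] (r : ℕ) :
    ∑ x : TPre α × TPre α, (topCount x).descFactorial r =
      ∑ y : (Fin r ⊕ Fin r ↪ α) × (Fin r → Bool), (topAll y.1 y.2).ncard := by
  classical
  have h1 : ∀ x : TPre α × TPre α, (topCount x).descFactorial r =
      (Finset.bipartiteAbove (fun x (y : (Fin r ⊕ Fin r ↪ α) × (Fin r → Bool)) =>
        x ∈ topAll y.1 y.2) Finset.univ x).card := by
    intro x
    rw [Finset.bipartiteAbove, ← Fintype.card_subtype, ← Nat.card_eq_fintype_card,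
      ← Nat.card_congr (topTuplesEquiv x r), Nat.card_eq_fintype_card, Fintype.card_embedding_eq,
      Fintype.card_fin, topCount, Nat.card_eq_fintype_card]
  rw [Finset.sum_congr rfl fun x _ => h1 x,
    Finset.sum_card_bipartiteAbove_eq_sum_card_bipartiteBelow]
  refine Finset.sum_congr rfl fun y _ => ?_
  rw [Finset.bipartiteBelow, Set.ncard_eq_toFinset_card']
  congr 1
  ext x
  simp

theorem noTop_eq [Finite α] : noTop α = {x | topCount x = 0} := by
  ext x
  rw [Set.mem_ofPred_eq, topCount, Finite.card_eq_zero_iff, isEmpty_subtype, Prod.forall]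
  simp only [Prod.forall]
  rfl

end Moments

end TPre

namespace TPre

section Limits

open Filter Topology

theorem succ_mul_fub_le (n : ℕ) : (n + 1) * fub n ≤ fub (n + 1) := by
  rw [fub_succ]
  refine le_trans ?_ (Finset.single_le_sum (f := fun k => (n + 1).choose k * fub k)
    (fun k _ => Nat.zero_le _) (Finset.self_mem_range_succ n))
  simp

theorem fub_pos (n : ℕ) : 0 < fub n := by
  induction n with
  | zero => simp [fub_zero]
  | succ n ih => exact lt_of_lt_of_le (by positivity) (succ_mul_fub_le n)

theorem fub_pred_le (n : ℕ) : fub (n - 1) ≤ fub n := by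
  cases n with
  | zero => rfl
  | succ n => exact (Nat.le_mul_of_pos_left _ n.succ_pos).trans (succ_mul_fub_le n)

theorem descFactorial_mul_fub_le {n j : ℕ} (h : j ≤ n) :
    n.descFactorial j * fub (n - j) ≤ fub n := by
  induction j with
  | zero => simp
  | succ j ih =>
    refine le_trans ?_ (ih (by omega))
    obtain ⟨k, rfl⟩ : ∃ k, n = k + 1 + j := ⟨n - (j + 1), by omega⟩
    have h1 := succ_mul_fub_le k
    rw [Nat.descFactorial_succ, show k + 1 + j - (j + 1) = k by omega,
      show k + 1 + j - j = k + 1 by omega, mul_comm (k + 1), mul_assoc]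
    exact Nat.mul_le_mul_left _ h1

theorem pow_le_exp_mul_descFactorial {n j : ℕ} (h : j ≤ n) :
    (n : ℝ) ^ j ≤ Real.exp j * n.descFactorial j := by
  have h1 : j.factorial * n ^ j ≤ n.descFactorial j * j ^ j := by
    rw [← Nat.descFactorial_self, Nat.descFactorial_eq_prod_range, Nat.descFactorial_eq_prod_range]
    have h0 : ∀ m : ℕ, m ^ j = ∏ i ∈ Finset.range j, m := by simp
    rw [h0 n, h0 j, ← Finset.prod_mul_distrib, ← Finset.prod_mul_distrib]
    refine Finset.prod_le_prod' fun i hi => ?_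
    rw [Nat.sub_mul, Nat.sub_mul, mul_comm j n]
    exact Nat.sub_le_sub_left (Nat.mul_le_mul_left i h) _
  have h2 : (j : ℝ) ^ j / j.factorial ≤ Real.exp j :=
    Real.pow_div_factorial_le_exp _ (Nat.cast_nonneg j) j
  have h3 : (0 : ℝ) < j.factorial := by positivity
  have h4 : (j.factorial : ℝ) * (n : ℝ) ^ j ≤ n.descFactorial j * (j : ℝ) ^ j := by exact_mod_cast h1
  rw [div_le_iff₀ h3] at h2
  have h5 := mul_le_mul_of_nonneg_left h2 (Nat.cast_nonneg (α := ℝ) (n.descFactorial j))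
  refine le_of_mul_le_mul_left (h4.trans (h5.trans (le_of_eq ?_))) h3
  ring

theorem pow_mul_fub_sub_div_le {n j : ℕ} (h : j ≤ n) :
    (n : ℝ) ^ j * fub (n - j) / fub n ≤ Real.exp j := by
  have h1 : (n.descFactorial j : ℝ) * fub (n - j) ≤ fub n := by
    exact_mod_cast descFactorial_mul_fub_le h
  rw [div_le_iff₀ (by exact_mod_cast fub_pos n)]
  have h2 := mul_le_mul_of_nonneg_right (pow_le_exp_mul_descFactorial h)
    (Nat.cast_nonneg (α := ℝ) (fub (n - j)))
  have h3 := mul_le_mul_of_nonneg_left h1 (Real.exp_pos j).le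
  linarith

theorem tendsto_pow_mul_fub_sub_div (j : ℕ) :
    Tendsto (fun n : ℕ => (n : ℝ) ^ j * fub (n - j) / fub n) atTop (𝓝 (Real.log 2 ^ j)) := by
  have hc : (1 / (2 * Real.log 2)) ≠ 0 := by
    have := log_two_pos
    positivity
  have h1 := ((tendsto_nfub.comp (tendsto_sub_atTop_nat j)).div tendsto_nfub hc).div
    (tendsto_descFactorial_div j) one_ne_zero
  have h2 := h1.mul_const (Real.log 2 ^ j)
  rw [div_self hc, div_one, one_mul] at h2
  refine h2.congr' ?_
  filter_upwards [eventually_ge_atTop (j + 1)] with n hn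
  obtain ⟨k, rfl⟩ : ∃ k, n = k + 1 + j := ⟨n - (j + 1), by omega⟩
  have hx := log_two_pos
  have hF : (fub (k + 1 + j) : ℝ) ≠ 0 := by exact_mod_cast (fub_pos _).ne'
  have hn : ((k + 1 + j : ℕ) : ℝ) ≠ 0 := by exact_mod_cast (by omega : k + 1 + j ≠ 0)
  have h3 : (((k + 1 + j).factorial : ℕ) : ℝ) =
      (k + 1).factorial * (k + 1 + j).descFactorial j := by
    have := Nat.factorial_mul_descFactorial (n := k + 1 + j) (k := j) (by omega)
    rw [Nat.add_sub_cancel] at this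
    exact_mod_cast this.symm
  have h4 : ((k + 1 + j).descFactorial j : ℝ) ≠ 0 := by
    exact_mod_cast (Nat.descFactorial_pos.2 (by omega)).ne'
  have h5 : ((k + 1).factorial : ℝ) ≠ 0 := by positivity
  simp only [Pi.div_apply, Function.comp, nfub, Nat.add_sub_cancel]
  rw [h3, pow_add _ (k + 1) j]
  field_simp

end Limits

end TPre

namespace TPre

section RedLimit

open Filter Topology

theorem abs_topAll_sub_le {n r : ℕ} (P : Fin r ⊕ Fin r ↪ Fin n) (σ : Fin r → Bool) :
    |(2 : ℝ) ^ r * (topAll P σ).ncard - (fub (n - r) : ℝ) ^ 2| ≤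
      2 ^ r * r ^ 2 * (2 + 2 ^ r * r ^ 2) * (fub (n - r) * fub (n - r - 1)) +
        2 ^ r * r * n * (fub (n - r - 1) : ℝ) ^ 2 := by
  have h1 := abs_ncard_pieces_sub_le P σ
  have h2 := abs_ncard_pieces_sub_le P fun i => !σ i
  have h3 : (Finset.univ.filter fun i => σ i = true).card +
      (Finset.univ.filter fun i => (!σ i) = true).card = r := by
    have := Finset.card_filter_add_card_filter_not (s := (Finset.univ : Finset (Fin r)))
      (fun i => σ i = true)
    simpa using this
  have h4 : ((niceAll P σ).ncard : ℝ) =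
      (pieces P σ).ncard * (pieces P fun i => !σ i).ncard := by
    rw [niceAll_eq, Set.ncard_prod]
    push_cast
    rfl
  have h5 : ((topAll P σ).ncard : ℝ) ≤ (niceAll P σ).ncard := by
    exact_mod_cast ncard_topAll_le P σ
  have h6 : ((niceAll P σ).ncard : ℝ) ≤
      (topAll P σ).ncard + r * n * (fub (n - r - 1) : ℝ) ^ 2 := by
    have := ncard_niceAll_le P σ
    rw [Nat.card_fin, Fintype.card_fin] at this
    exact_mod_cast this
  have h7 : (fub (n - r - 1) : ℝ) ≤ fub (n - r) := by exact_mod_cast fub_pred_le _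
  rw [Nat.card_fin, Fintype.card_fin] at h1 h2
  have hC : (0 : ℝ) ≤ 2 ^ r * r ^ 2 := by positivity
  have h8 : (2 : ℝ) ^ r * (niceAll P σ).ncard =
      (2 ^ (Finset.univ.filter fun i => σ i = true).card * (pieces P σ).ncard) *
      (2 ^ (Finset.univ.filter fun i => (!σ i) = true).card *
        (pieces P fun i => !σ i).ncard) := by
    rw [h4]
    nth_rw 1 [← h3]
    rw [pow_add]
    ring
  have ha : (0 : ℝ) ≤ 2 ^ (Finset.univ.filter fun i => σ i = true).card *
    (pieces P σ).ncard := by positivity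
  generalize (2 : ℝ) ^ (Finset.univ.filter fun i => σ i = true).card * (pieces P σ).ncard = a
    at h1 h8 ha
  generalize (2 : ℝ) ^ (Finset.univ.filter fun i => (!σ i) = true).card *
    (pieces P fun i => !σ i).ncard = b at h2 h8
  have hF : (0 : ℝ) ≤ fub (n - r) := Nat.cast_nonneg _
  have hF' : (0 : ℝ) ≤ fub (n - r - 1) := Nat.cast_nonneg _
  generalize (fub (n - r) : ℝ) = F at *
  generalize (fub (n - r - 1) : ℝ) = F' at *
  generalize (2 : ℝ) ^ r * r ^ 2 = C at *
  have h9 : |a * b - F ^ 2| ≤ C * (2 + C) * (F * F') := by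
    calc |a * b - F ^ 2| = |(a - F) * (b - F) + (a - F) * F + F * (b - F)| := by ring_nf
      _ ≤ |(a - F) * (b - F)| + |(a - F) * F| + |F * (b - F)| := abs_add_three _ _ _
      _ = |a - F| * |b - F| + |a - F| * F + F * |b - F| := by
        rw [abs_mul, abs_mul, abs_mul, abs_of_nonneg hF]
      _ ≤ (C * F') * (C * F') + (C * F') * F + F * (C * F') := by gcongr
      _ ≤ (C * F) * (C * F') + (C * F') * F + F * (C * F') := by gcongr
      _ = _ := by ring
  have hr : (0 : ℝ) < 2 ^ r := by positivity
  have h10 := mul_le_mul_of_nonneg_left h5 hr.le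
  have h11 := mul_le_mul_of_nonneg_left h6 hr.le
  rw [abs_le] at h9 ⊢
  have h12 : 0 ≤ (2 : ℝ) ^ r * (r * n * F' ^ 2) := by positivity
  constructor <;> linarith [h9.1, h9.2]

theorem abs_sum_descFactorial_sub_le [∀ n, Fintype (TPre (Fin n) × TPre (Fin n))] (n r : ℕ) :
    |(∑ x : TPre (Fin n) × TPre (Fin n), ((topCount x).descFactorial r : ℝ)) -
        n.descFactorial (2 * r) * (fub (n - r) : ℝ) ^ 2| ≤
      n.descFactorial (2 * r) * (2 ^ r * r ^ 2 * (2 + 2 ^ r * r ^ 2) *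
        (fub (n - r) * fub (n - r - 1)) + 2 ^ r * r * n * (fub (n - r - 1) : ℝ) ^ 2) := by
  have h1 := sum_descFactorial_topCount (α := Fin n) r
  have h2 : (∑ x : TPre (Fin n) × TPre (Fin n), ((topCount x).descFactorial r : ℝ)) =
      ∑ y : (Fin r ⊕ Fin r ↪ Fin n) × (Fin r → Bool), ((topAll y.1 y.2).ncard : ℝ) := by
    exact_mod_cast h1
  have hcard : Fintype.card ((Fin r ⊕ Fin r ↪ Fin n) × (Fin r → Bool)) =
      n.descFactorial (2 * r) * 2 ^ r := by
    rw [Fintype.card_prod, Fintype.card_embedding_eq, Fintype.card_fun]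
    simp [two_mul]
  have h3 : ∀ B : ℝ, ∑ y : (Fin r ⊕ Fin r ↪ Fin n) × (Fin r → Bool), B / 2 ^ r =
      n.descFactorial (2 * r) * B := by
    intro B
    rw [Finset.sum_const, Finset.card_univ, hcard, nsmul_eq_mul]
    push_cast
    field_simp
  rw [h2, ← h3, ← h3, ← Finset.sum_sub_distrib]
  refine (Finset.abs_sum_le_sum_abs _ _).trans (Finset.sum_le_sum fun y _ => ?_)
  have h4 := abs_topAll_sub_le y.1 y.2
  have hr : (0 : ℝ) < 2 ^ r := by positivity
  have h5 : ((topAll y.1 y.2).ncard : ℝ) - (fub (n - r) : ℝ) ^ 2 / 2 ^ r =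
      (2 ^ r * (topAll y.1 y.2).ncard - (fub (n - r) : ℝ) ^ 2) / 2 ^ r := by
    field_simp
  rw [h5, abs_div, abs_of_pos hr]
  gcongr

theorem tendsto_div_nat_zero {u : ℕ → ℝ} {l : ℝ} (h : Tendsto u atTop (𝓝 l)) :
    Tendsto (fun n => u n / n) atTop (𝓝 0) :=
  h.div_atTop tendsto_natCast_atTop_atTop

theorem tendsto_moment [∀ n, Fintype (TPre (Fin n) × TPre (Fin n))] (r : ℕ) :
    Tendsto (fun n => (∑ x : TPre (Fin n) × TPre (Fin n), ((topCount x).descFactorial r : ℝ)) /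
      (fub n : ℝ) ^ 2) atTop (𝓝 ((Real.log 2 ^ 2) ^ r)) := by
  have hd := tendsto_descFactorial_div (2 * r)
  have ha := tendsto_pow_mul_fub_sub_div r
  have hb := tendsto_pow_mul_fub_sub_div (r + 1)
  have hmain := hd.mul (ha.pow 2)
  rw [one_mul, pow_right_comm] at hmain
  have he1 := tendsto_div_nat_zero
    ((hd.mul (ha.mul hb)).const_mul ((2 : ℝ) ^ r * r ^ 2 * (2 + 2 ^ r * r ^ 2)))
  have he2 := tendsto_div_nat_zero ((hd.mul (hb.pow 2)).const_mul ((2 : ℝ) ^ r * r))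
  have he := he1.add he2
  rw [add_zero] at he
  rw [← sub_zero ((Real.log 2 ^ 2) ^ r)]
  have key : Tendsto (fun n => (∑ x : TPre (Fin n) × TPre (Fin n),
      ((topCount x).descFactorial r : ℝ)) / (fub n : ℝ) ^ 2 -
      (n.descFactorial (2 * r) : ℝ) / (n : ℝ) ^ (2 * r) * ((n : ℝ) ^ r * fub (n - r) / fub n) ^ 2)
      atTop (𝓝 0) := by
    refine squeeze_zero_norm' ?_ he
    filter_upwards [eventually_gt_atTop 0] with n hn
    have hn0 : (n : ℝ) ≠ 0 := by exact_mod_cast hn.ne'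
    have hF : (0 : ℝ) < fub n := by exact_mod_cast fub_pos n
    have h1 := abs_sum_descFactorial_sub_le n r
    rw [Real.norm_eq_abs]
    have h2 : (n.descFactorial (2 * r) : ℝ) / (n : ℝ) ^ (2 * r) *
        ((n : ℝ) ^ r * fub (n - r) / fub n) ^ 2 =
        n.descFactorial (2 * r) * (fub (n - r) : ℝ) ^ 2 / (fub n : ℝ) ^ 2 := by
      rw [pow_mul' (n : ℝ)]
      field_simp
    rw [h2, ← sub_div, abs_div, abs_of_pos (show (0 : ℝ) < (fub n : ℝ) ^ 2 by positivity),
      div_le_iff₀ (by positivity)]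
    refine h1.trans (le_of_eq ?_)
    rw [Nat.sub_sub, pow_mul' (n : ℝ)]
    field_simp
    ring
  simpa using key.add hmain

theorem tendsto_noTop : Tendsto (fun n => ((noTop (Fin n)).ncard : ℝ) / (fub n : ℝ) ^ 2) atTop
    (𝓝 (Real.exp (-Real.log 2 ^ 2))) := by
  have : ∀ n, Fintype (TPre (Fin n) × TPre (Fin n)) := fun n => Fintype.ofFinite _
  simp only [noTop_eq]
  exact tendsto_card_eq_zero_of_factorial_moments (fun n x => topCount x)
    (fun n => (fub n : ℝ) ^ 2) (fun n => by positivity) _ tendsto_moment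

theorem tendsto_red : Tendsto (fun n => (red n : ℝ) / (fub n : ℝ) ^ 2) atTop
    (𝓝 (Real.exp (-Real.log 2 ^ 2))) := by
  have h0 : ∀ n, red n = {x : TPre (Fin n) × TPre (Fin n) | Reduced x.1 x.2}.ncard :=
    fun n => Nat.card_coe_set_eq _
  have h1 := (tendsto_div_nat_zero ((tendsto_pow_mul_fub_sub_div 2).pow 2)).const_mul 64
  have h2 := tendsto_noTop.sub h1
  rw [mul_zero, sub_zero] at h2
  refine tendsto_of_tendsto_of_tendsto_of_le_of_le' h2 tendsto_noTop ?_ ?_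
  · filter_upwards [eventually_gt_atTop 0] with n hn
    have hn0 : (n : ℝ) ≠ 0 := by exact_mod_cast hn.ne'
    have hF : (0 : ℝ) < fub n := by exact_mod_cast fub_pos n
    have h3 : ((noTop (Fin n)).ncard : ℝ) ≤ red n + 64 * (n : ℝ) ^ 3 * (fub (n - 2) : ℝ) ^ 2 := by
      have := ncard_noTop_le (α := Fin n)
      rw [← h0, Nat.card_fin] at this
      exact_mod_cast this
    have h4 : 64 * (((n : ℝ) ^ 2 * fub (n - 2) / fub n) ^ 2 / n) =
        64 * (n : ℝ) ^ 3 * (fub (n - 2) : ℝ) ^ 2 / (fub n : ℝ) ^ 2 := by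
      field_simp
    rw [h4, ← sub_div]
    gcongr
    linarith
  · refine Eventually.of_forall fun n => ?_
    have := ncard_reduced_le (α := Fin n)
    rw [← h0] at this
    gcongr

end RedLimit

end TPre

namespace TPre

section Assembly

open Filter Topology

theorem red_le (n : ℕ) : red n ≤ fub n ^ 2 := by
  calc red n ≤ Nat.card (TPre (Fin n) × TPre (Fin n)) :=
        Nat.card_le_card_of_injective _ Subtype.val_injective
    _ = fub n ^ 2 := by rw [Nat.card_prod, sq, fub]

theorem cycNum_mul_red_div_le (n j : ℕ) :
    (cycNum n j : ℝ) * red (n - j) / (fub n : ℝ) ^ 2 ≤ (Real.exp 1 ^ 2 / 2) ^ j / j.factorial := by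
  rcases lt_or_ge n j with h | h
  · rw [cycNum_eq_zero h]
    simp only [Nat.cast_zero, zero_mul, zero_div]
    positivity
  · have hF : (0 : ℝ) < fub n := by exact_mod_cast fub_pos n
    have h1 : (red (n - j) : ℝ) ≤ (fub (n - j) : ℝ) ^ 2 := by exact_mod_cast red_le (n - j)
    calc (cycNum n j : ℝ) * red (n - j) / (fub n : ℝ) ^ 2
        ≤ (((n : ℝ) ^ 2 / 2) ^ j / j.factorial) * (fub (n - j) : ℝ) ^ 2 / (fub n : ℝ) ^ 2 := by
          gcongr
          exact cycNum_le n j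
      _ = ((n : ℝ) ^ j * fub (n - j) / fub n) ^ 2 / (2 ^ j * j.factorial) := by
          rw [div_pow, ← pow_mul, mul_comm 2 j, pow_mul]
          field_simp
      _ ≤ Real.exp j ^ 2 / (2 ^ j * j.factorial) := by
          gcongr
          exact pow_mul_fub_sub_div_le h
      _ = _ := by
          rw [← Real.exp_one_pow, div_pow, ← pow_mul, ← pow_mul, mul_comm 2 j]
          field_simp

theorem tendsto_cycNum_mul_red_div (j : ℕ) :
    Tendsto (fun n => (cycNum n j : ℝ) * red (n - j) / (fub n : ℝ) ^ 2) atTop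
      (𝓝 ((Real.log 2 ^ 2 / 2) ^ j / j.factorial * Real.exp (-Real.log 2 ^ 2))) := by
  have h := ((tendsto_cycNum_div j).mul ((tendsto_pow_mul_fub_sub_div j).pow 2)).mul
    (tendsto_red.comp (tendsto_sub_atTop_nat j))
  have hl : 1 / (2 ^ j * (j.factorial : ℝ)) * (Real.log 2 ^ j) ^ 2 * Real.exp (-Real.log 2 ^ 2) =
      (Real.log 2 ^ 2 / 2) ^ j / j.factorial * Real.exp (-Real.log 2 ^ 2) := by
    rw [div_pow, pow_right_comm]
    field_simp
  rw [hl] at h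
  refine h.congr' ?_
  filter_upwards [eventually_gt_atTop 0] with n hn
  have hn0 : (n : ℝ) ≠ 0 := by exact_mod_cast hn.ne'
  have hF : (fub n : ℝ) ≠ 0 := by exact_mod_cast (fub_pos n).ne'
  have hF' : (fub (n - j) : ℝ) ≠ 0 := by exact_mod_cast (fub_pos (n - j)).ne'
  rw [Function.comp, pow_mul' (n : ℝ)]
  field_simp

theorem tendsto_pdcCount_mul_factorial_div :
    Tendsto (fun n => (pdcCount n : ℝ) * n.factorial / (fub n : ℝ) ^ 2) atTop
      (𝓝 (Real.exp (-(Real.log 2) ^ 2 / 2))) := by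
  have h := tendsto_tsum_of_dominated_convergence
    (Real.summable_pow_div_factorial (Real.exp 1 ^ 2 / 2)) tendsto_cycNum_mul_red_div
    (Eventually.of_forall fun n j => by
      rw [Real.norm_of_nonneg (by positivity)]
      exact cycNum_mul_red_div_le n j)
  have hl : ∑' j : ℕ, (Real.log 2 ^ 2 / 2) ^ j / j.factorial * Real.exp (-Real.log 2 ^ 2) =
      Real.exp (-(Real.log 2) ^ 2 / 2) := by
    rw [tsum_mul_right, (NormedSpace.expSeries_div_hasSum_exp (Real.log 2 ^ 2 / 2)).tsum_eq,
      ← Real.exp_eq_exp_ℝ, ← Real.exp_add]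
    congr 1
    ring
  rw [hl] at h
  refine h.congr fun n => ?_
  rw [pdcCount_mul_factorial, Finset.sum_div]
  refine tsum_eq_sum fun j hj => ?_
  rw [cycNum_eq_zero (by simpa using hj)]
  simp

end Assembly

end TPre

theorem pdc_asymptotic :
    Filter.Tendsto
      (fun n : ℕ => (pdcCount n : ℝ) * (Real.log 2) ^ (2 * n) / (Nat.factorial n : ℝ))
      Filter.atTop
      (nhds (Real.exp (-(Real.log 2) ^ 2 / 2) / (4 * (Real.log 2) ^ 2))) := by
  have h := TPre.tendsto_pdcCount_mul_factorial_div.mul (TPre.tendsto_nfub.pow 2)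
  have hl : Real.exp (-(Real.log 2) ^ 2 / 2) * (1 / (2 * Real.log 2)) ^ 2 =
      Real.exp (-(Real.log 2) ^ 2 / 2) / (4 * (Real.log 2) ^ 2) := by
    rw [div_pow, mul_pow, one_pow, mul_one_div]
    norm_num
  rw [hl] at h
  refine h.congr fun n => ?_
  have hF : (TPre.fub n : ℝ) ≠ 0 := by exact_mod_cast (TPre.fub_pos n).ne'
  have hn : (n.factorial : ℝ) ≠ 0 := by positivity
  rw [TPre.nfub, pow_mul']
  field_simp
end

section
/- For all integers 0 ≤ k ≤ n, h_{2n,k} = (-1)^k · (2k)! · T(n,k), where h_{t,c} = Σ_{m=c}^{t-c} (-1)^m (c+m)! · S2(t, c+m) · C(m-1, m-c) and T(n,k) is defined by the recurrence T(n,0)=0 for n ≥ 1, T(n,n)=1 for n ≥ 0, and T(n,k) = T(n-1,k-1) + k^2·T(n-1,k) for 1 ≤ k ≤ n-1. -/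
/-- Stirling numbers of the second kind. -/
def S2 : ℕ → ℕ → ℕ
  | 0, 0 => 1
  | 0, _ + 1 => 0
  | _ + 1, 0 => 0
  | n + 1, k + 1 => (k + 1) * S2 n (k + 1) + S2 n k

/-- `h t c = ∑_{m=c}^{t-c} (-1)^m (c+m)! · S2(t, c+m) · C(m-1, m-c)`. -/
def hInt (t c : ℕ) : ℤ :=
  ∑ m ∈ Finset.Icc c (t - c),
    (-1 : ℤ) ^ m * (Nat.factorial (c + m) : ℤ) * (S2 t (c + m) : ℤ) *
      (Nat.choose (m - 1) (m - c) : ℤ)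

/-- The triangle `T(n,k)` (OEIS A036969), defined by `T(n,0) = 0` for `n ≥ 1`,
`T(n,n) = 1`, and `T(n,k) = T(n-1,k-1) + k² T(n-1,k)` for `1 ≤ k ≤ n-1`
(together with `T(n,k) = 0` for `k > n`). -/
def T : ℕ → ℕ → ℕ
  | 0, 0 => 1
  | 0, _ + 1 => 0
  | _ + 1, 0 => 0
  | n + 1, k + 1 => T n k + (k + 1) ^ 2 * T n (k + 1)

theorem S2_eq_zero_of_lt : ∀ {n k : ℕ}, n < k → S2 n k = 0
  | _, 0, h => by omega
  | 0, _ + 1, _ => by simp [S2]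
  | n + 1, k + 1, h => by
    rw [S2, S2_eq_zero_of_lt (by omega : n < k + 1), S2_eq_zero_of_lt (by omega : n < k), mul_zero]

/-- The linear functional `w ↦ ∑_j w(j) · j! · S2(t, j)`, summing `w` over surjection numbers. -/
def surjSum (t : ℕ) (w : ℕ → ℤ) : ℤ :=
  ∑ j ∈ Finset.range (t + 1), w j * ((Nat.factorial j : ℤ) * (S2 t j : ℤ))

/-- The adjoint of the recurrence of the surjection numbers `j! · S2(t, j)` in `t`. -/
def surjAdjoint (w : ℕ → ℤ) (j : ℕ) : ℤ :=
  j * w j + (j + 1) * w (j + 1)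

theorem surjSum_succ (t : ℕ) (w : ℕ → ℤ) : surjSum (t + 1) w = surjSum t (surjAdjoint w) := by
  have hshift : ∑ j ∈ Finset.range (t + 1),
        ((j : ℤ) + 1) * w (j + 1) * ((Nat.factorial (j + 1) : ℤ) * (S2 t (j + 1) : ℤ)) =
      ∑ j ∈ Finset.range (t + 1), (j : ℤ) * w j * ((Nat.factorial j : ℤ) * (S2 t j : ℤ)) := by
    have h := Finset.sum_range_succ'
      (fun j : ℕ => (j : ℤ) * w j * ((Nat.factorial j : ℤ) * (S2 t j : ℤ))) (t + 1)
    rw [Finset.sum_range_succ] at h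
    simpa [S2_eq_zero_of_lt (Nat.lt_succ_self t)] using h.symm
  unfold surjSum surjAdjoint
  rw [Finset.sum_range_succ']
  simp only [add_mul, Finset.sum_add_distrib]
  rw [← hshift, ← Finset.sum_add_distrib]
  simp only [S2, Nat.cast_zero, mul_zero, add_zero]
  rw [← Finset.sum_add_distrib]
  refine Finset.sum_congr rfl fun j _ => ?_
  rw [Nat.factorial_succ]
  push_cast
  ring

/-- The signed weight of `j! · S2(t, j)` in `h_{t,k}`. -/
def hWeight (k j : ℕ) : ℤ :=
  if 2 * k ≤ j then (-1) ^ (j + k) * (Nat.multichoose k (j - 2 * k) : ℤ) else 0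

theorem hWeight_add (k d : ℕ) :
    hWeight k (2 * k + d) = (-1) ^ (k + d) * (Nat.multichoose k d : ℤ) := by
  have h : 2 * k + d + k = 2 * k + (k + d) := by ring
  simp [hWeight, h, pow_add, pow_mul]

theorem hWeight_of_lt {k j : ℕ} (h : j < 2 * k) : hWeight k j = 0 := by
  simp [hWeight, h]

theorem succ_mul_multichoose_succ (k d : ℕ) :
    (d + 1) * Nat.multichoose (k + 1) (d + 1) = (k + d + 1) * Nat.multichoose (k + 1) d := by
  rw [Nat.multichoose_eq, Nat.multichoose_eq]
  have h := Nat.add_one_mul_choose_eq (k + d) d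
  rw [show k + 1 + (d + 1) - 1 = k + d + 1 by omega, show k + 1 + d - 1 = k + d by omega]
  linarith

theorem surjAdjoint_surjAdjoint_hWeight_succ (k j : ℕ) :
    surjAdjoint (surjAdjoint (hWeight (k + 1))) j =
      (k + 1) ^ 2 * hWeight (k + 1) j - (2 * k + 2) * (2 * k + 1) * hWeight k j := by
  unfold surjAdjoint
  rcases lt_or_ge j (2 * k) with hj | hj
  · rw [hWeight_of_lt (by omega : j < 2 * (k + 1)), hWeight_of_lt (by omega : j + 1 < 2 * (k + 1)),
      hWeight_of_lt (by omega : j + 1 + 1 < 2 * (k + 1)), hWeight_of_lt hj]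
    ring
  obtain ⟨d, rfl⟩ := Nat.exists_eq_add_of_le hj
  rw [hWeight_add]
  match d with
  | 0 =>
    rw [hWeight_of_lt (by omega : 2 * k + 0 < 2 * (k + 1)),
      hWeight_of_lt (by omega : 2 * k + 0 + 1 < 2 * (k + 1)),
      show 2 * k + 0 + 1 + 1 = 2 * (k + 1) + 0 by ring, hWeight_add]
    simp only [Nat.multichoose_zero_right]
    push_cast
    ring
  | 1 =>
    rw [hWeight_of_lt (by omega : 2 * k + 1 < 2 * (k + 1)),
      show 2 * k + 1 + 1 = 2 * (k + 1) + 0 by ring,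
      show 2 * (k + 1) + 0 + 1 = 2 * (k + 1) + 1 by ring, hWeight_add, hWeight_add]
    simp only [Nat.multichoose_zero_right, Nat.multichoose_one_right]
    push_cast
    ring
  | d + 2 =>
    rw [show 2 * k + (d + 2) = 2 * (k + 1) + d by ring,
      show 2 * (k + 1) + d + 1 = 2 * (k + 1) + (d + 1) by ring,
      show 2 * (k + 1) + (d + 1) + 1 = 2 * (k + 1) + (d + 2) by ring,
      hWeight_add, hWeight_add, hWeight_add]
    have h₀ : (Nat.multichoose (k + 1) (d + 2) : ℤ) =
        Nat.multichoose k (d + 2) + Nat.multichoose (k + 1) (d + 1) := by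
      exact_mod_cast Nat.multichoose_succ_succ k (d + 1)
    have h₁ : ((d : ℤ) + 1) * Nat.multichoose (k + 1) (d + 1) =
        (k + d + 1) * Nat.multichoose (k + 1) d := by
      exact_mod_cast succ_mul_multichoose_succ k d
    have h₂ : ((d : ℤ) + 2) * Nat.multichoose (k + 1) (d + 2) =
        (k + d + 2) * Nat.multichoose (k + 1) (d + 1) := by
      exact_mod_cast succ_mul_multichoose_succ k (d + 1)
    have h₃ : (Nat.multichoose k (d + 2) : ℤ) =
        Nat.multichoose (k + 1) (d + 2) - Nat.multichoose (k + 1) (d + 1) := by linarith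
    rw [h₃]
    generalize (Nat.multichoose (k + 1) d : ℤ) = a at *
    generalize (Nat.multichoose (k + 1) (d + 1) : ℤ) = b at *
    generalize (Nat.multichoose (k + 1) (d + 2) : ℤ) = c at *
    push_cast
    simp only [pow_add, pow_one]
    generalize (-1 : ℤ) ^ k = s
    generalize (-1 : ℤ) ^ d = e
    linear_combination (-s * e) * ((4 * k + d + 5) * h₂ - (3 * k + d + 3) * h₁)

theorem surjAdjoint_hWeight_zero (j : ℕ) : surjAdjoint (hWeight 0) j = 0 := by
  cases j <;> simp [surjAdjoint, hWeight]

theorem surjSum_hWeight (n k : ℕ) :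
    surjSum (2 * n) (hWeight k) = (-1 : ℤ) ^ k * (Nat.factorial (2 * k) : ℤ) * (T n k : ℤ) := by
  induction n generalizing k with
  | zero => cases k <;> simp [surjSum, hWeight, S2, T]
  | succ n ih =>
    rw [show 2 * (n + 1) = 2 * n + 1 + 1 by ring, surjSum_succ]
    cases k with
    | zero => simp [funext surjAdjoint_hWeight_zero, surjSum, T]
    | succ k =>
      rw [surjSum_succ, funext (surjAdjoint_surjAdjoint_hWeight_succ k)]
      have hlin : surjSum (2 * n) (fun j => ((k : ℤ) + 1) ^ 2 * hWeight (k + 1) j -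
            (2 * k + 2) * (2 * k + 1) * hWeight k j) =
          ((k : ℤ) + 1) ^ 2 * surjSum (2 * n) (hWeight (k + 1)) -
            (2 * k + 2) * (2 * k + 1) * surjSum (2 * n) (hWeight k) := by
        simp only [surjSum, sub_mul, Finset.sum_sub_distrib, Finset.mul_sum, mul_assoc]
      rw [hlin, ih, ih, T, show 2 * (k + 1) = 2 * k + 1 + 1 by ring, Nat.factorial_succ,
        Nat.factorial_succ]
      push_cast
      ring

theorem hInt_eq_surjSum {t k : ℕ} (h : 2 * k ≤ t) : hInt t k = surjSum t (hWeight k) := by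
  have hsub : Finset.Icc (2 * k) t ⊆ Finset.range (t + 1) := fun j hj => by
    simp only [Finset.mem_Icc, Finset.mem_range] at *
    omega
  unfold hInt surjSum
  rw [← Finset.sum_subset hsub fun j hj hj' => by
    simp only [Finset.mem_Icc, Finset.mem_range] at *
    rw [hWeight_of_lt (by omega), zero_mul]]
  refine Finset.sum_nbij' (k + ·) (· - k) ?_ ?_ ?_ ?_ ?_
  · intro m hm
    simp only [Finset.mem_Icc] at *
    omega
  · intro m hm
    simp only [Finset.mem_Icc] at *
    omega
  · intro m hm
    simp
  · intro m hm
    simp only [Finset.mem_Icc] at *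
    omega
  · intro m hm
    obtain ⟨d, rfl⟩ := Nat.exists_eq_add_of_le (Finset.mem_Icc.mp hm).1
    rw [show k + (k + d) = 2 * k + d by ring, hWeight_add, Nat.multichoose_eq,
      Nat.add_sub_cancel_left]
    ring

theorem h2n_eq_T (n k : ℕ) (h : k ≤ n) :
    hInt (2 * n) k = (-1 : ℤ) ^ k * (Nat.factorial (2 * k) : ℤ) * (T n k : ℤ) := by
  rw [hInt_eq_surjSum (by omega), surjSum_hWeight]
end
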